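/- Let g be a C^{3,1} function on ℝ² with supp g ⊆ [−M,M] × [0,1] and g(x,0) = g(x,1) = 0 for all x. Then for all λ ∈ ℝ, ‖e^{λx} g‖_{L⁸(ℝ×[0,1])} ≤ c ‖e^{λx}(∂_t g + ∂_x³ g)‖_{L^{8/7}(ℝ×[0,1])} with c independent of λ. -/

import Mathlib

open MeasureTheory

noncomputable def pdx (f : ℝ × ℝ → ℝ) : ℝ × ℝ → ℝ := fun p => deriv (fun x => f (x, p.2)) p.1
noncomputable def pdt (f : ℝ × ℝ → ℝ) : ℝ × ℝ → ℝ := fun p => deriv (fun t => f (p.1, t)) p.2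

/-- `f ∈ C^{3,1}`: three continuous spatial derivatives and one continuous time derivative. -/
def C31 (f : ℝ × ℝ → ℝ) : Prop :=
  (∀ t, ContDiff ℝ 3 (fun x => f (x, t))) ∧ (∀ x, Differentiable ℝ (fun t => f (x, t))) ∧
  Continuous f ∧ Continuous (pdx f) ∧ Continuous (pdx (pdx f)) ∧
  Continuous (pdx (pdx (pdx f))) ∧ Continuous (pdt f)

/-- First derivative test for the cubic phase on an interval where its derivative has size at least one. -/
theorem norm_integral_exp_cubic_le_of_one_le {a b y s : ℝ} (ha : 0 ≤ a) (hab : a ≤ b)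
    (hs : |s| = 1)
    (h : (∀ x ∈ Set.Icc a b, 1 ≤ 3 * x ^ 2 + y) ∨ (∀ x ∈ Set.Icc a b, 3 * x ^ 2 + y ≤ -1)) :
    ‖∫ x in a..b, Complex.exp (Complex.I * ((s * (x ^ 3 + y * x) : ℝ) : ℂ))‖ ≤ 3 := by
  have hne : ∀ x ∈ Set.Icc a b, 3 * x ^ 2 + y ≠ 0 := by
    rintro x hx h0
    rcases h with h | h <;> linarith [h x hx]
  set e : ℝ → ℂ := fun x => Complex.exp (Complex.I * ((s * (x ^ 3 + y * x) : ℝ) : ℂ)) with he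
  set w : ℝ → ℝ := fun x => 6 * x / (3 * x ^ 2 + y) ^ 2 with hw
  have he1 : ∀ x, ‖e x‖ = 1 := fun x => by
    simp only [he]; rw [mul_comm]; exact Complex.norm_exp_ofReal_mul_I _
  have hec : Continuous e := by simp only [he]; fun_prop
  have hwc : ContinuousOn w (Set.uIcc a b) := by
    rw [Set.uIcc_of_le hab]
    apply ContinuousOn.div (by fun_prop) (by fun_prop)
    intro x hx; exact pow_ne_zero _ (hne x hx)
  set G : ℝ → ℂ := fun x => e x * ((s / (3 * x ^ 2 + y) : ℝ) : ℂ) with hG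
  have hs2 : s * s = 1 := by rw [← abs_mul_abs_self, hs, one_mul]
  have hGd : ∀ x ∈ Set.uIcc a b, HasDerivAt G
      (Complex.I * e x - ((s * w x : ℝ) : ℂ) * e x) x := by
    intro x hx
    rw [Set.uIcc_of_le hab] at hx
    have h0 := hne x hx
    have h1 : HasDerivAt (fun x : ℝ => s * (x ^ 3 + y * x)) (s * (3 * x ^ 2 + y)) x := by
      have := (((hasDerivAt_id x).pow 3).add ((hasDerivAt_id x).const_mul y)).const_mul s
      convert! this using 1; simp
    have h2 : HasDerivAt e (e x * (Complex.I * ((s * (3 * x ^ 2 + y) : ℝ) : ℂ))) x :=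
      (h1.ofReal_comp.const_mul Complex.I).cexp
    have h3 : HasDerivAt (fun x : ℝ => s / (3 * x ^ 2 + y)) (-(s * w x)) x := by
      have h4 : HasDerivAt (fun x : ℝ => 3 * x ^ 2 + y) (6 * x) x := by
        have := (((hasDerivAt_id x).pow 2).const_mul 3).add_const y
        convert! this using 1; simp; ring
      have := (hasDerivAt_const x s).div h4 h0
      convert! this using 1; simp [hw]; ring
    have := h2.mul h3.ofReal_comp
    convert! this using 1
    have h5 : (s * (3 * x ^ 2 + y)) * (s / (3 * x ^ 2 + y)) = 1 := by
      field_simp; linarith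
    have h6 : ((s * (3 * x ^ 2 + y) : ℝ) : ℂ) * ((s / (3 * x ^ 2 + y) : ℝ) : ℂ) = 1 := by
      rw [← Complex.ofReal_mul, h5]; simp
    rw [show e x * (Complex.I * ((s * (3 * x ^ 2 + y) : ℝ) : ℂ)) * ((s / (3 * x ^ 2 + y) : ℝ) : ℂ)
      = e x * Complex.I * (((s * (3 * x ^ 2 + y) : ℝ) : ℂ) * ((s / (3 * x ^ 2 + y) : ℝ) : ℂ)) by ring,
      h6]
    push_cast; ring
  have hwd : ∀ x ∈ Set.uIcc a b, HasDerivAt (fun x : ℝ => -(3 * x ^ 2 + y)⁻¹) (w x) x := by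
    intro x hx
    rw [Set.uIcc_of_le hab] at hx
    have h4 : HasDerivAt (fun x : ℝ => 3 * x ^ 2 + y) (6 * x) x := by
      have := (((hasDerivAt_id x).pow 2).const_mul 3).add_const y
      convert! this using 1; simp; ring
    have := (h4.inv (hne x hx)).neg
    convert! this using 1; simp [hw]; ring
  have hswc : ContinuousOn (fun x => ((s * w x : ℝ) : ℂ) * e x) (Set.uIcc a b) :=
    (Complex.continuous_ofReal.comp_continuousOn (hwc.const_smul s)).mul hec.continuousOn
  have hIe : Continuous fun x => Complex.I * e x := by fun_prop
  have i1 := intervalIntegral.integral_eq_sub_of_hasDerivAt hGd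
    ((hIe.continuousOn.sub hswc).intervalIntegrable)
  have i2 := intervalIntegral.integral_eq_sub_of_hasDerivAt hwd hwc.intervalIntegrable
  rw [intervalIntegral.integral_sub (hIe.intervalIntegrable _ _)
    hswc.intervalIntegrable, intervalIntegral.integral_const_mul] at i1
  have hI : ‖∫ x in a..b, e x‖ = ‖Complex.I * ∫ x in a..b, e x‖ := by simp
  have hwb : ‖∫ x in a..b, ((s * w x : ℝ) : ℂ) * e x‖ ≤ ∫ x in a..b, w x := by
    apply intervalIntegral.norm_integral_le_of_norm_le hab _ hwc.intervalIntegrable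
    refine ae_of_all _ fun x hx => ?_
    rw [norm_mul, he1, Complex.norm_real, mul_one, norm_mul, Real.norm_eq_abs, hs, one_mul,
      Real.norm_eq_abs, abs_of_nonneg]
    have : 0 ≤ x := ha.trans hx.1.le
    simp only [hw]; positivity
  have hGb : ∀ x ∈ Set.Icc a b, ‖G x‖ ≤ 1 := by
    intro x hx
    simp only [hG]
    rw [norm_mul, he1, Complex.norm_real, one_mul, norm_div, Real.norm_eq_abs, hs,
      Real.norm_eq_abs]
    apply div_le_one_of_le₀ _ (abs_nonneg _)
    rcases h with h | h
    · exact (h x hx).trans (le_abs_self _)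
    · have := h x hx
      have := neg_le_abs (3 * x ^ 2 + y); linarith
  have hend : (∫ x in a..b, w x) ≤ 1 := by
    rw [i2]
    have ma : a ∈ Set.Icc a b := ⟨le_rfl, hab⟩
    have mb : b ∈ Set.Icc a b := ⟨hab, le_rfl⟩
    rcases h with h | h
    · have h1 := inv_le_one_of_one_le₀ (h a ma)
      have h2 : 0 ≤ (3 * b ^ 2 + y)⁻¹ := inv_nonneg.2 (by linarith [h b mb])
      linarith
    · have h1 : (-(3 * b ^ 2 + y))⁻¹ ≤ 1 := inv_le_one_of_one_le₀ (by linarith [h b mb])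
      have h2 : 0 ≤ (-(3 * a ^ 2 + y))⁻¹ := inv_nonneg.2 (by linarith [h a ma])
      rw [inv_neg] at h1 h2
      linarith
  rw [hI, sub_eq_iff_eq_add.1 i1]
  calc _ ≤ ‖G b‖ + ‖G a‖ + ‖∫ x in a..b, ((s * w x : ℝ) : ℂ) * e x‖ :=
        (norm_add_le _ _).trans (by gcongr; exact norm_sub_le _ _)
    _ ≤ 1 + 1 + 1 := by
        gcongr
        · exact hGb b ⟨hab, le_rfl⟩
        · exact hGb a ⟨le_rfl, hab⟩
        · exact hwb.trans hend
    _ = 3 := by norm_num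

theorem norm_integral_exp_cubic_le_of_nonneg {a b s : ℝ} (y : ℝ) (ha : 0 ≤ a) (hab : a ≤ b)
    (hs : |s| = 1) :
    ‖∫ x in a..b, Complex.exp (Complex.I * ((s * (x ^ 3 + y * x) : ℝ) : ℂ))‖ ≤ 7 := by
  set e : ℝ → ℂ := fun x => Complex.exp (Complex.I * ((s * (x ^ 3 + y * x) : ℝ) : ℂ)) with he
  have hec : Continuous e := by simp only [he]; fun_prop
  have he1 : ∀ x, ‖e x‖ = 1 := fun x => by
    simp only [he]; rw [mul_comm]; exact Complex.norm_exp_ofReal_mul_I _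
  set p := √((-y - 1) / 3) with hp
  set q := √((1 - y) / 3) with hq
  have hpq : p ≤ q := Real.sqrt_le_sqrt (by linarith)
  have hq1 : q ≤ p + 1 := by
    rw [hq, Real.sqrt_le_left (by positivity)]
    have : (-y - 1) / 3 ≤ p ^ 2 := by
      rcases le_total 0 ((-y - 1) / 3) with h | h
      · rw [hp, Real.sq_sqrt h]
      · exact h.trans (sq_nonneg p)
    nlinarith [Real.sqrt_nonneg ((-y - 1) / 3)]
  set p' := max a (min p b) with hp'
  set q' := max a (min q b) with hq'
  have h1 : a ≤ p' := le_max_left _ _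
  have h2 : p' ≤ q' := max_le_max le_rfl (min_le_min hpq le_rfl)
  have h3 : q' ≤ b := max_le hab (min_le_right _ _)
  have b1 : ‖∫ x in a..p', e x‖ ≤ 3 := by
    rcases h1.eq_or_lt with h | h
    · rw [← h]; simp
    apply norm_integral_exp_cubic_le_of_one_le ha h1 hs
    right
    intro x hx
    have hap : p' ≤ p := by
      rcases le_total (min p b) a with h' | h'
      · rw [hp', max_eq_left h'] at h; exact absurd h (lt_irrefl _)
      · rw [hp', max_eq_right h']; exact min_le_left _ _
    have hp0 : 0 < p := lt_of_le_of_lt ha (h.trans_le hap)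
    have h0 : 0 < (-y - 1) / 3 := Real.sqrt_pos.1 hp0
    have : x ^ 2 ≤ p ^ 2 := by
      have := ha.trans hx.1
      gcongr; exact hx.2.trans hap
    rw [hp, Real.sq_sqrt h0.le] at this
    linarith
  have b3 : ‖∫ x in q'..b, e x‖ ≤ 3 := by
    rcases h3.eq_or_lt with h | h
    · rw [h]; simp
    apply norm_integral_exp_cubic_le_of_one_le (ha.trans (h1.trans h2)) h3 hs
    left
    intro x hx
    have hqq : q ≤ q' := by
      rcases le_total q b with h' | h'
      · rw [hq', min_eq_left h']; exact le_max_right _ _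
      · rw [hq', min_eq_right h', max_eq_right hab] at h; exact absurd h (lt_irrefl _)
    have hx2 := (Real.sqrt_le_left (ha.trans (h1.trans (h2.trans hx.1)))).1 (hqq.trans hx.1)
    linarith
  have b2 : ‖∫ x in p'..q', e x‖ ≤ 1 := by
    have := intervalIntegral.norm_integral_le_of_norm_le_const (a := p') (b := q') (C := 1)
      (f := e) (fun x _ => (he1 x).le)
    rw [abs_of_nonneg (by linarith), one_mul] at this
    have : q' ≤ p' + 1 := by
      apply max_le (by linarith)
      rcases le_total p b with h' | h'
      · rw [hp', min_eq_left h']; exact (min_le_left _ _).trans (by linarith [le_max_right a p])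
      · rw [hp', min_eq_right h']; exact (min_le_right _ _).trans (by linarith [le_max_right a b])
    linarith
  have hi : ∀ u v, IntervalIntegrable e volume u v := fun u v => hec.intervalIntegrable u v
  rw [← intervalIntegral.integral_add_adjacent_intervals (hi a q') (hi q' b),
    ← intervalIntegral.integral_add_adjacent_intervals (hi a p') (hi p' q')]
  have := norm_add_le ((∫ x in a..p', e x) + ∫ x in p'..q', e x) (∫ x in q'..b, e x)
  have := norm_add_le (∫ x in a..p', e x) (∫ x in p'..q', e x)
  linarith

theorem norm_integral_exp_cubic_le {a b s : ℝ} (y : ℝ) (hab : a ≤ b) (hs : |s| = 1) :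
    ‖∫ x in a..b, Complex.exp (Complex.I * ((s * (x ^ 3 + y * x) : ℝ) : ℂ))‖ ≤ 14 := by
  have hneg : ∀ {a b s : ℝ}, a ≤ b → b ≤ 0 → |s| = 1 →
      ‖∫ x in a..b, Complex.exp (Complex.I * ((s * (x ^ 3 + y * x) : ℝ) : ℂ))‖ ≤ 7 := by
    intro a b s hab hb hs
    have := norm_integral_exp_cubic_le_of_nonneg (a := -b) (b := -a) (s := -s) y (by linarith)
      (by linarith) (by rwa [abs_neg])
    rw [← intervalIntegral.integral_comp_neg] at this
    convert! this using 6
    push_cast; ring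
  rcases le_total 0 a with ha | ha
  · linarith [norm_integral_exp_cubic_le_of_nonneg y ha hab hs]
  rcases le_total b 0 with hb | hb
  · linarith [hneg hab hb hs]
  have hi : ∀ u v, IntervalIntegrable (fun x : ℝ => Complex.exp (Complex.I *
      ((s * (x ^ 3 + y * x) : ℝ) : ℂ))) volume u v :=
    fun u v => Continuous.intervalIntegrable (by fun_prop) u v
  rw [← intervalIntegral.integral_add_adjacent_intervals (hi a 0) (hi 0 b)]
  refine (norm_add_le _ _).trans ?_
  linarith [hneg ha le_rfl hs, norm_integral_exp_cubic_le_of_nonneg y le_rfl hb hs]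

/-- Uniform van der Corput estimate for a cubic phase. -/
theorem norm_integral_exp_mul_cubic_le {a b σ : ℝ} (y : ℝ) (hab : a ≤ b) (hσ : σ ≠ 0) :
    ‖∫ x in a..b, Complex.exp (Complex.I * ((σ * x ^ 3 + y * x : ℝ) : ℂ))‖
      ≤ 14 * |σ| ^ (-(1 / 3) : ℝ) := by
  have hpos : 0 < |σ| := abs_pos.2 hσ
  set c := |σ| ^ (1 / 3 : ℝ) with hc
  have hc0 : 0 < c := by positivity
  have hc3 : c ^ 3 = |σ| := by
    rw [hc, ← Real.rpow_natCast, ← Real.rpow_mul hpos.le]; norm_num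
  set s := σ / |σ| with hs
  have hs1 : |s| = 1 := by rw [hs, abs_div, abs_abs, div_self hpos.ne']
  have hs2 : s * s = 1 := by rw [← abs_mul_abs_self, hs1, one_mul]
  have key := norm_integral_exp_cubic_le (a := c * a) (b := c * b) (s * y / c)
    (by gcongr) hs1
  have := intervalIntegral.integral_comp_mul_left (a := a) (b := b)
    (fun x : ℝ => Complex.exp (Complex.I * ((s * (x ^ 3 + s * y / c * x) : ℝ) : ℂ))) hc0.ne'
  rw [show (∫ x in a..b, Complex.exp (Complex.I * ((σ * x ^ 3 + y * x : ℝ) : ℂ))) =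
    ∫ x in a..b, Complex.exp (Complex.I * ((s * ((c * x) ^ 3 + s * y / c * (c * x)) : ℝ) : ℂ)) from ?_,
    this, norm_smul, Real.norm_eq_abs, abs_of_pos (by positivity), Real.rpow_neg hpos.le, ← hc,
    mul_comm]
  · gcongr
  · congr 1; ext x; congr 3
    rw [mul_pow, hc3, mul_add, ← mul_assoc, hs, div_mul_cancel₀ _ hpos.ne', ← hs]
    congr 1
    field_simp
    rw [pow_two, hs2, mul_one]

open FourierTransform ENNReal in
/-- The Fourier transform on `L²` is given by the Fourier integral on `L¹ ∩ L²`. -/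
theorem fourier_toLp_ae_eq {u : ℝ → ℂ} (h1 : Integrable u) (h2 : MemLp u 2 volume) :
    (𝓕 (h2.toLp u) : Lp ℂ 2 (volume : Measure ℝ)) =ᵐ[volume] 𝓕 u := by
  have hc : Continuous (𝓕 u) := VectorFourier.fourierIntegral_continuous
    Real.continuous_fourierChar (innerSL ℝ).continuous₂ h1
  apply ae_eq_of_integral_contDiff_smul_eq
  · exact (Lp.memLp _).locallyIntegrable (by norm_num)
  · exact hc.locallyIntegrable
  intro g hg hgs
  have hgc : HasCompactSupport (fun x => (g x : ℂ)) := hgs.comp_left (g := Complex.ofReal) (by simp)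
  have hgd : ContDiff ℝ (⊤ : ℕ∞) (fun x => (g x : ℂ)) := Complex.ofRealCLM.contDiff.comp hg
  set φ : SchwartzMap ℝ ℂ := hgc.toSchwartzMap hgd with hφ
  have hφg : ∀ x, φ x = g x := fun x => rfl
  have e1 := congrArg (fun T : TemperedDistribution ℝ ℂ => T φ)
    (Lp.fourier_toTemperedDistribution_eq (h2.toLp u))
  simp only [TemperedDistribution.fourier_apply, Lp.toTemperedDistribution_apply] at e1
  have e2 : ∫ x, g x • 𝓕 u x = ∫ x, 𝓕 u x • φ x := by
    congr 1; ext x; rw [hφg, smul_eq_mul, mul_comm]; rfl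
  have e3 : ∫ x, 𝓕 u x • φ x = ∫ x, u x • 𝓕 (φ : ℝ → ℂ) x := by
    have := VectorFourier.integral_fourierIntegral_smul_eq_flip (μ := volume) (ν := volume)
      (L := innerₗ ℝ) Real.continuous_fourierChar continuous_inner h1 φ.integrable
    rw [flip_innerₗ] at this
    exact this
  have e4 : ∫ x, g x • (𝓕 (h2.toLp u) : Lp ℂ 2 (volume : Measure ℝ)) x =
      ∫ x, φ x • (𝓕 (h2.toLp u) : Lp ℂ 2 (volume : Measure ℝ)) x := by
    congr 1
  rw [e2, e3, e4, ← e1]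
  apply integral_congr_ae
  filter_upwards [h2.coeFn_toLp] with x hx
  rw [hx, smul_eq_mul, smul_eq_mul, mul_comm]
  rfl

open FourierTransform ENNReal in
theorem eLpNorm_fourier {u : ℝ → ℂ} (h1 : Integrable u) (h2 : MemLp u 2 volume) :
    eLpNorm (𝓕 u) 2 volume = eLpNorm u 2 volume := by
  rw [← eLpNorm_congr_ae (fourier_toLp_ae_eq h1 h2), ← eLpNorm_congr_ae h2.coeFn_toLp,
    ← Lp.enorm_def, ← Lp.enorm_def, ← ofReal_norm, ← ofReal_norm, Lp.norm_fourier_eq]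

open FourierTransform ENNReal in
theorem memLp_fourier {u : ℝ → ℂ} (h1 : Integrable u) (h2 : MemLp u 2 volume) :
    MemLp (𝓕 u) 2 volume :=
  (memLp_congr_ae (fourier_toLp_ae_eq h1 h2)).1 (Lp.memLp _)

open FourierTransform ENNReal ComplexConjugate in
/-- Parseval's identity on `L¹ ∩ L²`. -/
theorem integral_conj_fourier_mul_fourier {u v : ℝ → ℂ} (h1 : Integrable u)
    (h2 : MemLp u 2 volume) (h3 : Integrable v) (h4 : MemLp v 2 volume) :
    ∫ x, conj (𝓕 v x) * 𝓕 u x = ∫ x, conj (v x) * u x := by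
  have := Lp.inner_fourier_eq (h4.toLp v) (h2.toLp u)
  rw [L2.inner_def, L2.inner_def] at this
  have e1 : ∫ x, conj (𝓕 v x) * 𝓕 u x = ∫ x, inner ℂ
      ((𝓕 (h4.toLp v) : Lp ℂ 2 (volume : Measure ℝ)) x)
      ((𝓕 (h2.toLp u) : Lp ℂ 2 (volume : Measure ℝ)) x) := by
    apply integral_congr_ae
    filter_upwards [fourier_toLp_ae_eq h1 h2, fourier_toLp_ae_eq h3 h4] with x hx hy
    rw [hx, hy, RCLike.inner_apply']
  rw [e1, this]
  apply integral_congr_ae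
  filter_upwards [h2.coeFn_toLp, h4.coeFn_toLp] with x hx hy
  rw [hx, hy, RCLike.inner_apply']

open FourierTransform in
theorem integral_fourier_mul_eq {u v : ℝ → ℂ} (h1 : Integrable u) (h3 : Integrable v) :
    ∫ x, 𝓕 u x * v x = ∫ x, u x * 𝓕 v x := by
  have := VectorFourier.integral_fourierIntegral_smul_eq_flip (μ := volume) (ν := volume)
      (L := innerₗ ℝ) Real.continuous_fourierChar continuous_inner h1 h3
  rw [flip_innerₗ] at this
  exact this

open FourierTransform in
theorem continuous_fourier_of_integrable {u : ℝ → ℂ} (h1 : Integrable u) : Continuous (𝓕 u) :=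
  VectorFourier.fourierIntegral_continuous
    Real.continuous_fourierChar (innerSL ℝ).continuous₂ h1

open FourierTransform in
theorem norm_fourier_le {u : ℝ → ℂ} (x : ℝ) : ‖𝓕 u x‖ ≤ ∫ y, ‖u y‖ := by
  rw [Real.fourier_eq]
  apply (norm_integral_le_integral_norm _).trans
  simp_rw [Circle.norm_smul]; rfl

open FourierTransform in
/-- The Fourier multiplier operator with symbol `m`. -/
noncomputable def fourierMul (m u : ℝ → ℂ) : ℝ → ℂ := 𝓕⁻ (fun ξ => m ξ * 𝓕 u ξ)

section
open FourierTransform ENNReal ComplexConjugate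
variable {m u v : ℝ → ℂ}

theorem integrable_mul_fourier (hm : Integrable m) (hu : Integrable u) :
    Integrable (fun ξ => m ξ * 𝓕 u ξ) := by
  apply hm.mul_bdd (c := ∫ y, ‖u y‖) (continuous_fourier_of_integrable hu).aestronglyMeasurable
  exact ae_of_all _ fun x => norm_fourier_le x

theorem continuous_fourierMul (hm : Integrable m) (hu : Integrable u) :
    Continuous (fourierMul m u) := by
  have : fourierMul m u = fun x => 𝓕 (fun ξ => m ξ * 𝓕 u ξ) (-x) := by
    ext x; exact Real.fourierInv_eq_fourier_neg _ _
  rw [this]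
  exact (continuous_fourier_of_integrable (integrable_mul_fourier hm hu)).comp continuous_neg

theorem fourierMul_add (hm : Integrable m) (hu : Integrable u) (hv : Integrable v) (x : ℝ) :
    fourierMul m (u + v) x = fourierMul m u x + fourierMul m v x := by
  have h : ∀ ξ, 𝓕 (u + v) ξ = 𝓕 u ξ + 𝓕 v ξ := by
    intro ξ
    rw [Real.fourier_eq, Real.fourier_eq, Real.fourier_eq, ← integral_add]
    · simp [smul_add]
    · exact (Real.fourierIntegral_convergent_iff _).2 hu
    · exact (Real.fourierIntegral_convergent_iff _).2 hv
  simp only [fourierMul, Real.fourierInv_eq_fourier_neg, h, mul_add]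
  rw [Real.fourier_eq, Real.fourier_eq, Real.fourier_eq, ← integral_add]
  · simp [smul_add]
  · exact (Real.fourierIntegral_convergent_iff _).2 (integrable_mul_fourier hm hu)
  · exact (Real.fourierIntegral_convergent_iff _).2 (integrable_mul_fourier hm hv)

theorem norm_fourierMul_le {D : ℝ} (hD : ∀ x, ‖𝓕 m x‖ ≤ D) (hm : Integrable m)
    (hu : Integrable u) (x : ℝ) : ‖fourierMul m u x‖ ≤ D * ∫ y, ‖u y‖ := by
  set e : ℝ → ℂ := fun ξ => (Real.fourierChar (inner ℝ ξ x) : ℂ) * m ξ with he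
  have hei : Integrable e := by
    have := (Real.fourierIntegral_convergent_iff (f := m) (μ := volume) (-x)).2 hm
    simpa [he, Circle.smul_def] using this
  have e1 : fourierMul m u x = ∫ ξ, 𝓕 e ξ * u ξ := by
    rw [integral_fourier_mul_eq hei hu, fourierMul, Real.fourierInv_eq]
    congr 1; ext ξ; simp only [he, Circle.smul_def, smul_eq_mul]; ring
  have e2 : ∀ ξ, 𝓕 e ξ = 𝓕 m (ξ - x) := by
    intro ξ
    rw [Real.fourier_eq, Real.fourier_eq]
    congr 1; ext y
    simp only [he, Circle.smul_def, smul_eq_mul, ← mul_assoc]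
    congr 1
    rw [← Circle.coe_mul, ← AddChar.map_add_eq_mul, inner_sub_right]
    congr 2; ring
  rw [e1, ← integral_const_mul]
  apply norm_integral_le_of_norm_le (hu.norm.const_mul D)
  refine ae_of_all _ fun y => ?_
  rw [norm_mul, e2]
  gcongr
  exact hD _

theorem eLpNorm_fourierMul_le (hm : Integrable m) (hm1 : ∀ x, ‖m x‖ ≤ 1)
    (hu : Integrable u) (hu2 : MemLp u 2 volume) :
    eLpNorm (fourierMul m u) 2 volume ≤ eLpNorm u 2 volume := by
  set w : ℝ → ℂ := fun ξ => m ξ * 𝓕 u ξ with hw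
  have hwi : Integrable w := integrable_mul_fourier hm hu
  have hle : ∀ x, ‖w x‖ ≤ ‖𝓕 u x‖ := fun x => by
    rw [hw, norm_mul]; exact mul_le_of_le_one_left (norm_nonneg _) (hm1 x)
  have hw2 : MemLp w 2 volume :=
    (memLp_fourier hu hu2).mono hwi.aestronglyMeasurable (ae_of_all _ hle)
  have : fourierMul m u = (𝓕 w) ∘ Neg.neg := by
    ext x; exact Real.fourierInv_eq_fourier_neg _ _
  rw [this, eLpNorm_comp_measurePreserving
    (continuous_fourier_of_integrable hwi).aestronglyMeasurable
    (Measure.measurePreserving_neg (volume : Measure ℝ)), eLpNorm_fourier hwi hw2, ← eLpNorm_fourier hu hu2]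
  exact eLpNorm_mono hle

theorem integral_conj_fourier_mul (hm : Integrable m) (hu : Integrable u) (hv : Integrable v) :
    ∫ ξ, conj (𝓕 v ξ) * (m ξ * 𝓕 u ξ) = ∫ x, conj (v x) * fourierMul m u x := by
  set w : ℝ → ℂ := fun ξ => m ξ * 𝓕 u ξ with hw
  have hwi : Integrable w := integrable_mul_fourier hm hu
  have hcv : Integrable (fun x => conj (v (-x))) :=
    (Complex.conjCLE.toContinuousLinearMap.integrable_comp (hv.comp_neg))
  have e1 : ∀ ξ, conj (𝓕 v ξ) = 𝓕 (fun x => conj (v (-x))) ξ := by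
    intro ξ
    rw [Real.fourier_eq, Real.fourier_eq, ← integral_conj, ← integral_neg_eq_self]
    congr 1; ext y
    simp [Circle.smul_def, ← Circle.coe_inv_eq_conj, ← AddChar.map_neg_eq_inv]
  simp_rw [e1]
  rw [integral_fourier_mul_eq hcv hwi, ← integral_neg_eq_self]
  congr 1; ext x
  rw [neg_neg, fourierMul, Real.fourierInv_eq_fourier_neg]
end

section
open FourierTransform ENNReal ComplexConjugate
variable {m u v : ℝ → ℂ} {D : ℝ}

theorem measure_lt_norm_fourierMul_le (hm : Integrable m) (hm1 : ∀ x, ‖m x‖ ≤ 1)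
    (hD : ∀ x, ‖𝓕 m x‖ ≤ D) (hum : Measurable u) (hu : Integrable u) (hu2 : MemLp u 2 volume)
    (hP : Integrable (fun x => ‖u x‖ ^ (8 / 7 : ℝ))) (hD0 : 0 < D)
    (hP0 : 0 < ∫ x, ‖u x‖ ^ (8 / 7 : ℝ)) {a : ℝ} (ha : 0 < a) :
    volume {x | a < ‖fourierMul m u x‖} ≤ ENNReal.ofReal (4 * a ^ (-2 : ℝ)) *
      ∫⁻ y, {y | ‖u y‖ ≤ (2 * D * (∫ x, ‖u x‖ ^ (8 / 7 : ℝ)) / a) ^ (7 : ℝ)}.indicator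
        (fun y => ENNReal.ofReal (‖u y‖ ^ (2 : ℝ))) y := by
  set P := ∫ x, ‖u x‖ ^ (8 / 7 : ℝ) with hPdef
  set γ := (2 * D * P / a) ^ (7 : ℝ) with hγ
  have hγ0 : 0 < γ := by positivity
  set S := {y | ‖u y‖ ≤ γ} with hS
  have hSm : MeasurableSet S := measurableSet_le hum.norm measurable_const
  set u₁ := Sᶜ.indicator u
  set u₂ := S.indicator u
  have hu₁ : Integrable u₁ := hu.indicator hSm.compl
  have hu₂ : Integrable u₂ := hu.indicator hSm
  have hu₂2 : MemLp u₂ 2 volume := hu2.indicator hSm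
  have hadd : u₁ + u₂ = u := Set.indicator_compl_add_self S u
  have hγ7 : γ ^ (-(1 / 7) : ℝ) = a / (2 * D * P) := by
    rw [hγ, ← Real.rpow_mul (by positivity)]
    norm_num
    rw [Real.rpow_neg_one, inv_div]
  have h1 : ∫ y, ‖u₁ y‖ ≤ a / (2 * D * P) * P := by
    rw [hPdef, ← integral_const_mul]
    apply integral_mono hu₁.norm (hP.const_mul _)
    intro y
    show ‖Sᶜ.indicator u y‖ ≤ a / (2 * D * P) * ‖u y‖ ^ (8 / 7 : ℝ)
    by_cases hy : y ∈ S
    · rw [Set.indicator_of_notMem (by simpa using hy)]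
      simp only [norm_zero]; positivity
    · rw [Set.indicator_of_mem (by simpa using hy)]
      have hy' : γ < ‖u y‖ := not_le.1 hy
      have hy0 : 0 < ‖u y‖ := hγ0.trans hy'
      rw [← hγ7]
      calc ‖u y‖ = ‖u y‖ ^ (-(1 / 7) : ℝ) * ‖u y‖ ^ (8 / 7 : ℝ) := by
            rw [← Real.rpow_add hy0]; norm_num
        _ ≤ _ := by
            gcongr ?_ * _
            exact Real.rpow_le_rpow_of_nonpos hγ0 hy'.le (by norm_num)
  have h2 : ∀ x, ‖fourierMul m u₁ x‖ ≤ a / 2 := by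
    intro x
    refine (norm_fourierMul_le hD hm hu₁ x).trans ?_
    calc D * ∫ y, ‖u₁ y‖ ≤ D * (a / (2 * D * P) * P) := by gcongr
      _ = a / 2 := by field_simp
  have h3 : {x | a < ‖fourierMul m u x‖} ⊆ {x | ENNReal.ofReal (a / 2) ≤ ‖fourierMul m u₂ x‖ₑ} := by
    intro x hx
    simp only [Set.mem_ofPred_eq] at hx ⊢
    rw [← hadd, fourierMul_add hm hu₁ hu₂] at hx
    rw [← ofReal_norm]
    apply ENNReal.ofReal_le_ofReal
    have := norm_add_le (fourierMul m u₁ x) (fourierMul m u₂ x)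
    linarith [h2 x]
  have h4 := meas_ge_le_mul_pow_eLpNorm_enorm volume (p := 2) (by norm_num) (by norm_num)
    (continuous_fourierMul hm hu₂).aestronglyMeasurable (ε := ENNReal.ofReal (a / 2))
    (by simpa using ha)  (by simp)
  refine (measure_mono h3).trans (h4.trans ?_)
  have h5 : eLpNorm (fourierMul m u₂) 2 volume ^ (2 : ℝ≥0∞).toReal ≤
      ∫⁻ y, S.indicator (fun y => ENNReal.ofReal (‖u y‖ ^ (2 : ℝ))) y := by
    calc _ ≤ eLpNorm u₂ 2 volume ^ (2 : ℝ≥0∞).toReal := by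
          gcongr; exact eLpNorm_fourierMul_le hm hm1 hu₂ hu₂2
      _ = ∫⁻ y, ‖u₂ y‖ₑ ^ (2 : ℝ) := by
          rw [eLpNorm_eq_lintegral_rpow_enorm_toReal (by norm_num) (by norm_num),
            ← ENNReal.rpow_mul]
          norm_num
      _ = _ := by
          apply lintegral_congr
          intro y
          by_cases hy : y ∈ S
          · rw [Set.indicator_of_mem hy, show u₂ y = u y from Set.indicator_of_mem hy _,
              ← ofReal_norm, ENNReal.ofReal_rpow_of_nonneg (norm_nonneg _) (by norm_num)]
          · rw [Set.indicator_of_notMem hy, show u₂ y = 0 from Set.indicator_of_notMem hy _]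
            simp
  refine mul_le_mul' (le_of_eq ?_) h5
  rw [← ENNReal.ofReal_inv_of_pos (by positivity), ENNReal.toReal_ofNat,
    ENNReal.ofReal_rpow_of_nonneg (by positivity) (by norm_num)]
  congr 1
  rw [inv_div, Real.div_rpow (by norm_num) ha.le, Real.rpow_neg ha.le]
  norm_num; ring

/-- Interpolation between `L¹ → L^∞` and `L² → L²` for a Fourier multiplier. -/
theorem lintegral_norm_fourierMul_le (hm : Integrable m) (hm1 : ∀ x, ‖m x‖ ≤ 1)
    (hD : ∀ x, ‖𝓕 m x‖ ≤ D) (hum : Measurable u) (hu : Integrable u) (hu2 : MemLp u 2 volume)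
    (hP : Integrable (fun x => ‖u x‖ ^ (8 / 7 : ℝ))) (hD0 : 0 < D) :
    ∫⁻ x, ENNReal.ofReal (‖fourierMul m u x‖ ^ (8 : ℝ)) ≤
      ENNReal.ofReal (342 * D ^ 6 * (∫ x, ‖u x‖ ^ (8 / 7 : ℝ)) ^ 7) := by
  set P := ∫ x, ‖u x‖ ^ (8 / 7 : ℝ) with hPdef
  have hPn : 0 ≤ P := integral_nonneg fun x => by positivity
  rcases hPn.eq_or_lt with hP0 | hP0
  · have h0 : (fun x => ‖u x‖ ^ (8 / 7 : ℝ)) =ᵐ[volume] 0 :=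
      (integral_eq_zero_iff_of_nonneg (fun x => by positivity) hP).1 hP0.symm
    have h1 : ∫ x, ‖u x‖ = 0 := by
      rw [integral_eq_zero_iff_of_nonneg (fun x => by positivity) hu.norm]
      filter_upwards [h0] with x hx
      exact ((Real.rpow_eq_zero_iff_of_nonneg (norm_nonneg _)).1 hx).1
    have h2 : ∀ x, fourierMul m u x = 0 := fun x => by
      have := norm_fourierMul_le hD hm hu x
      rw [h1, mul_zero] at this
      exact norm_le_zero_iff.1 this
    simp [h2]
  rw [lintegral_rpow_eq_lintegral_meas_lt_mul volume (ae_of_all _ fun x => norm_nonneg _)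
    (continuous_fourierMul hm hu).norm.aemeasurable (by norm_num)]
  set S : ℝ → Set ℝ := fun a => {y | ‖u y‖ ≤ (2 * D * P / a) ^ (7 : ℝ)} with hS
  set w : ℝ → ℝ≥0∞ := fun y => ENNReal.ofReal (‖u y‖ ^ (2 : ℝ)) with hw
  have hwm : Measurable w := (hum.norm.pow_const _).ennreal_ofReal
  have step1 : ∫⁻ a in Set.Ioi (0 : ℝ), volume {x | a < ‖fourierMul m u x‖} *
      ENNReal.ofReal (a ^ ((8 : ℝ) - 1)) ≤
      ∫⁻ a in Set.Ioi (0 : ℝ), ∫⁻ y, ENNReal.ofReal (4 * a ^ (5 : ℝ)) * (S a).indicator w y := by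
    apply setLIntegral_mono' measurableSet_Ioi
    intro a ha
    have ha' : 0 < a := ha
    have hSa : MeasurableSet (S a) := measurableSet_le hum.norm measurable_const
    rw [lintegral_const_mul _ (hwm.indicator hSa)]
    calc _ ≤ _ := mul_le_mul_left (measure_lt_norm_fourierMul_le hm hm1 hD hum hu hu2 hP hD0 hP0 ha') _
      _ = _ := by
        rw [mul_right_comm, ← ENNReal.ofReal_mul (by positivity), mul_assoc 4,
          ← Real.rpow_add ha']
        norm_num [hS, hw, hPdef]
  have step2 : ∫⁻ a in Set.Ioi (0 : ℝ), ∫⁻ y, ENNReal.ofReal (4 * a ^ (5 : ℝ)) * (S a).indicator w y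
      = ∫⁻ y, ∫⁻ a in Set.Ioi (0 : ℝ), ENNReal.ofReal (4 * a ^ (5 : ℝ)) * (S a).indicator w y := by
    apply lintegral_lintegral_swap
    apply Measurable.aemeasurable
    apply Measurable.mul
    · fun_prop
    · have hset : MeasurableSet {p : ℝ × ℝ | ‖u p.2‖ ≤ (2 * D * P / p.1) ^ (7 : ℝ)} :=
        measurableSet_le (by fun_prop) (by fun_prop)
      exact (hwm.comp measurable_snd).indicator hset
  have step3 : ∀ y, ∫⁻ a in Set.Ioi (0 : ℝ), ENNReal.ofReal (4 * a ^ (5 : ℝ)) * (S a).indicator w y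
      ≤ ENNReal.ofReal (4 / 6 * (2 * D * P) ^ 6 * ‖u y‖ ^ (8 / 7 : ℝ)) := by
    intro y
    rcases (norm_nonneg (u y)).eq_or_lt with h0 | h0
    · have : w y = 0 := by simp [hw, norm_eq_zero.1 h0.symm]
      have : ∀ a, (S a).indicator w y = 0 := fun a => by
        by_cases h : y ∈ S a
        · rw [Set.indicator_of_mem h, this]
        · rw [Set.indicator_of_notMem h]
      simp [this]
    set A := 2 * D * P * ‖u y‖ ^ (-(1 / 7) : ℝ) with hA
    have hA0 : 0 < A := by positivity
    calc _ ≤ ∫⁻ a in Set.Ioi (0 : ℝ), (Set.Ioc 0 A).indicator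
          (fun a => ENNReal.ofReal (4 * ‖u y‖ ^ (2 : ℝ) * a ^ 5)) a := by
          apply setLIntegral_mono' measurableSet_Ioi
          intro a ha
          have ha' : 0 < a := ha
          by_cases h : y ∈ S a
          · have h' : ‖u y‖ ≤ (2 * D * P / a) ^ (7 : ℝ) := h
            have haA : a ≤ A := by
              have : ‖u y‖ ^ (1 / 7 : ℝ) ≤ 2 * D * P / a := by
                calc _ ≤ ((2 * D * P / a) ^ (7 : ℝ)) ^ (1 / 7 : ℝ) := by gcongr
                  _ = _ := by rw [← Real.rpow_mul (by positivity)]; norm_num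
              rw [hA, Real.rpow_neg h0.le, ← div_eq_mul_inv, le_div_iff₀ (by positivity)]
              rw [le_div_iff₀ ha'] at this
              linarith
            rw [Set.indicator_of_mem h, Set.indicator_of_mem (show a ∈ Set.Ioc 0 A from ⟨ha', haA⟩), hw,
              ← ENNReal.ofReal_mul (by positivity)]
            apply le_of_eq; congr 1
            rw [show (5 : ℝ) = ((5 : ℕ) : ℝ) by norm_num, Real.rpow_natCast]; ring
          · rw [Set.indicator_of_notMem h, mul_zero]; exact zero_le
      _ ≤ ∫⁻ a, (Set.Ioc 0 A).indicator
          (fun a => ENNReal.ofReal (4 * ‖u y‖ ^ (2 : ℝ) * a ^ 5)) a := setLIntegral_le_lintegral _ _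
      _ = ∫⁻ a in Set.Ioc 0 A, ENNReal.ofReal (4 * ‖u y‖ ^ (2 : ℝ) * a ^ 5) :=
          lintegral_indicator measurableSet_Ioc _
      _ = ENNReal.ofReal (∫ a in (0)..A, 4 * ‖u y‖ ^ (2 : ℝ) * a ^ 5) := by
          rw [intervalIntegral.integral_of_le hA0.le, ofReal_integral_eq_lintegral_ofReal]
          · exact (Continuous.intervalIntegrable (by fun_prop) 0 A).1
          · filter_upwards [ae_restrict_mem measurableSet_Ioc] with a ha
            have := ha.1.le
            show 0 ≤ 4 * ‖u y‖ ^ (2 : ℝ) * a ^ 5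
            positivity
      _ = _ := by
          congr 1
          rw [intervalIntegral.integral_const_mul, integral_pow, hA, mul_pow, ← Real.rpow_natCast
            (‖u y‖ ^ (-(1 / 7) : ℝ)), ← Real.rpow_mul h0.le]
          have : ‖u y‖ ^ (8 / 7 : ℝ) = ‖u y‖ ^ (2 : ℝ) * ‖u y‖ ^ (-(1 / 7) * ((5 + 1 : ℕ) : ℝ)) := by
            rw [← Real.rpow_add h0]; norm_num
          rw [this]
          push_cast
          ring
  calc _ ≤ ENNReal.ofReal 8 * ∫⁻ y, ENNReal.ofReal (4 / 6 * (2 * D * P) ^ 6 * ‖u y‖ ^ (8 / 7 : ℝ)) := by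
        exact mul_le_mul' le_rfl (step1.trans (step2.le.trans (lintegral_mono step3)))
    _ = ENNReal.ofReal (8 * (4 / 6 * (2 * D * P) ^ 6 * P)) := by
        rw [ENNReal.ofReal_mul (by norm_num), ← ofReal_integral_eq_lintegral_ofReal
          (hP.const_mul _) (ae_of_all _ fun y => by positivity), integral_const_mul]
    _ ≤ _ := by
        apply ENNReal.ofReal_le_ofReal
        have : 0 ≤ D ^ 6 * P ^ 7 := by positivity
        nlinarith

theorem enorm_integral_conj_mul_fourierMul_le (hm : Integrable m) (hm1 : ∀ x, ‖m x‖ ≤ 1)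
    (hD : ∀ x, ‖𝓕 m x‖ ≤ D) (hum : Measurable u) (hu : Integrable u) (hu2 : MemLp u 2 volume)
    (hP : Integrable (fun x => ‖u x‖ ^ (8 / 7 : ℝ))) (hD0 : 0 < D) (hv : Measurable v) :
    ‖∫ x, conj (v x) * fourierMul m u x‖ₑ ≤ ENNReal.ofReal (3 * D ^ (3 / 4 : ℝ)) *
      (∫⁻ x, ‖u x‖ₑ ^ (8 / 7 : ℝ)) ^ (7 / 8 : ℝ) * (∫⁻ x, ‖v x‖ₑ ^ (8 / 7 : ℝ)) ^ (7 / 8 : ℝ) := by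
  set P := ∫ x, ‖u x‖ ^ (8 / 7 : ℝ) with hPdef
  have hP0 : 0 ≤ P := integral_nonneg fun x => by positivity
  have hPe : ∫⁻ x, ‖u x‖ₑ ^ (8 / 7 : ℝ) = ENNReal.ofReal P := by
    rw [hPdef, ofReal_integral_eq_lintegral_ofReal hP (ae_of_all _ fun y => by positivity)]
    apply lintegral_congr; intro y
    rw [← ofReal_norm, ENNReal.ofReal_rpow_of_nonneg (norm_nonneg _) (by norm_num)]
  have h8 : (∫⁻ x, ‖fourierMul m u x‖ₑ ^ (8 : ℝ)) ^ (1 / 8 : ℝ) ≤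
      ENNReal.ofReal (3 * D ^ (3 / 4 : ℝ)) * (∫⁻ x, ‖u x‖ₑ ^ (8 / 7 : ℝ)) ^ (7 / 8 : ℝ) := by
    rw [hPe, ENNReal.ofReal_rpow_of_nonneg hP0 (by norm_num), ← ENNReal.ofReal_mul (by positivity)]
    have : ∫⁻ x, ‖fourierMul m u x‖ₑ ^ (8 : ℝ) ≤
        ENNReal.ofReal ((3 * D ^ (3 / 4 : ℝ) * P ^ (7 / 8 : ℝ)) ^ (8 : ℝ)) := by
      refine le_trans (le_of_eq ?_) ((lintegral_norm_fourierMul_le hm hm1 hD hum hu hu2 hP hD0).trans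
        (ENNReal.ofReal_le_ofReal ?_))
      · apply lintegral_congr; intro y
        rw [← ofReal_norm, ENNReal.ofReal_rpow_of_nonneg (norm_nonneg _) (by norm_num)]
      · rw [Real.mul_rpow (by positivity) (by positivity), Real.mul_rpow (by positivity) (by positivity),
          ← Real.rpow_mul hD0.le, ← Real.rpow_mul hP0]
        norm_num
        rw [← hPdef]
        gcongr
        norm_num
    calc _ ≤ _ := ENNReal.rpow_le_rpow this (by norm_num)
      _ = _ := by
        rw [ENNReal.ofReal_rpow_of_nonneg (by positivity) (by norm_num), ← Real.rpow_mul (by positivity)]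
        norm_num
  calc _ ≤ ∫⁻ x, ‖conj (v x) * fourierMul m u x‖ₑ := enorm_integral_le_lintegral_enorm _
    _ = ∫⁻ x, (((fun x => ‖fourierMul m u x‖ₑ) * fun x => ‖v x‖ₑ : ℝ → ℝ≥0∞)) x := by
        apply lintegral_congr; intro x
        rw [enorm_mul, mul_comm, RCLike.enorm_conj]; rfl
    _ ≤ _ := ENNReal.lintegral_mul_le_Lp_mul_Lq volume
        (⟨by norm_num, by norm_num, by norm_num⟩ : Real.HolderConjugate 8 (8 / 7))
        (continuous_fourierMul hm hu).enorm.aemeasurable hv.enorm.aemeasurable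
    _ ≤ _ := by
        rw [show (1 / (8 / 7) : ℝ) = 7 / 8 by norm_num]
        gcongr
end

section
open ENNReal

theorem lintegral_comp_abs_eq (f : ℝ → ℝ≥0∞) :
    ∫⁻ x, f |x| = 2 * ∫⁻ x in Set.Ioi 0, f x := by
  have h1 : ∫⁻ x in Set.Ioi 0, f |x| = ∫⁻ x in Set.Ioi 0, f x :=
    setLIntegral_congr_fun measurableSet_Ioi fun x hx => by rw [abs_of_pos hx]
  have h2 : ∫⁻ x in Set.Iio 0, f |x| = ∫⁻ x in Set.Ioi 0, f |x| := by
    have := (Measure.measurePreserving_neg (volume : Measure ℝ)).setLIntegral_comp_preimage_emb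
      (MeasurableEquiv.neg ℝ).measurableEmbedding (fun x => f |x|) (Set.Ioi 0)
    rw [← this]
    simp
  rw [← lintegral_add_compl _ (measurableSet_Ioi (a := (0 : ℝ))), Set.compl_Ioi,
    setLIntegral_congr Iio_ae_eq_Iic.symm, h2, h1, two_mul]

theorem lintegral_indicator_lt_abs_rpow_le {R : ℝ} (hR : 0 < R) :
    ∫⁻ t : ℝ, ENNReal.ofReal (if |t| < R then |t| ^ (-(1 / 4) : ℝ) else 0)
      ≤ ENNReal.ofReal (8 / 3 * R ^ (3 / 4 : ℝ)) := by
  have h := lintegral_comp_abs_eq fun r => ENNReal.ofReal (if r < R then r ^ (-(1 / 4) : ℝ) else 0)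
  have hi : IntervalIntegrable (fun r : ℝ => r ^ (-(1 / 4) : ℝ)) volume 0 R :=
    intervalIntegral.intervalIntegrable_rpow' (by norm_num)
  have h2 : ∫⁻ r in Set.Ioi (0 : ℝ), ENNReal.ofReal (if r < R then r ^ (-(1 / 4) : ℝ) else 0) ≤
      ENNReal.ofReal (4 / 3 * R ^ (3 / 4 : ℝ)) := by
    calc _ ≤ ∫⁻ r in Set.Ioi (0 : ℝ), (Set.Ioc 0 R).indicator
          (fun r => ENNReal.ofReal (r ^ (-(1 / 4) : ℝ))) r := by
          apply setLIntegral_mono' measurableSet_Ioi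
          intro r hr
          split_ifs with hrR
          · rw [Set.indicator_of_mem (show r ∈ Set.Ioc 0 R from ⟨hr, hrR.le⟩)]
          · simp
      _ ≤ ∫⁻ r, (Set.Ioc 0 R).indicator (fun r => ENNReal.ofReal (r ^ (-(1 / 4) : ℝ))) r :=
          setLIntegral_le_lintegral _ _
      _ = ∫⁻ r in Set.Ioc 0 R, ENNReal.ofReal (r ^ (-(1 / 4) : ℝ)) :=
          lintegral_indicator measurableSet_Ioc _
      _ = ENNReal.ofReal (∫ r in (0)..R, r ^ (-(1 / 4) : ℝ)) := by
          rw [intervalIntegral.integral_of_le hR.le, ofReal_integral_eq_lintegral_ofReal hi.1]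
          filter_upwards [ae_restrict_mem measurableSet_Ioc] with a ha
          exact Real.rpow_nonneg ha.1.le _
      _ = _ := by
          rw [integral_rpow (by norm_num)]
          congr 1
          norm_num
          ring
  rw [h]
  calc _ ≤ 2 * ENNReal.ofReal (4 / 3 * R ^ (3 / 4 : ℝ)) := by gcongr
    _ = _ := by
      rw [show (2 : ℝ≥0∞) = ENNReal.ofReal 2 by simp, ← ENNReal.ofReal_mul (by norm_num)]
      congr 1; ring

theorem lintegral_indicator_ge_abs_rpow_le {R : ℝ} (hR : 0 < R) :
    ∫⁻ t : ℝ, ENNReal.ofReal (if R ≤ |t| then |t| ^ (-(1 / 4) : ℝ) else 0) ^ (8 : ℝ)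
      ≤ ENNReal.ofReal (2 * R⁻¹) := by
  have h := lintegral_comp_abs_eq
    fun r => ENNReal.ofReal (if R ≤ r then r ^ (-(1 / 4) : ℝ) else 0) ^ (8 : ℝ)
  have h2 : ∫⁻ r in Set.Ioi (0 : ℝ),
      ENNReal.ofReal (if R ≤ r then r ^ (-(1 / 4) : ℝ) else 0) ^ (8 : ℝ) ≤ ENNReal.ofReal R⁻¹ := by
    calc _ ≤ ∫⁻ r in Set.Ioi (0 : ℝ), (Set.Ici R).indicator
          (fun r => ENNReal.ofReal (r ^ (-2 : ℝ))) r := by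
          apply setLIntegral_mono' measurableSet_Ioi
          intro r hr
          have hr' : 0 < r := hr
          split_ifs with hrR
          · rw [Set.indicator_of_mem (show r ∈ Set.Ici R from hrR),
              ENNReal.ofReal_rpow_of_nonneg (by positivity) (by norm_num),
              ← Real.rpow_mul hr'.le]
            norm_num
          · simp
      _ ≤ ∫⁻ r, (Set.Ici R).indicator (fun r => ENNReal.ofReal (r ^ (-2 : ℝ))) r :=
          setLIntegral_le_lintegral _ _
      _ = ∫⁻ r in Set.Ioi R, ENNReal.ofReal (r ^ (-2 : ℝ)) := by
          rw [lintegral_indicator measurableSet_Ici, setLIntegral_congr Ioi_ae_eq_Ici.symm]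
      _ = ENNReal.ofReal (∫ r in Set.Ioi R, r ^ (-2 : ℝ)) := by
          rw [ofReal_integral_eq_lintegral_ofReal (integrableOn_Ioi_rpow_of_lt (by norm_num) hR)]
          filter_upwards [ae_restrict_mem measurableSet_Ioi] with a ha
          exact Real.rpow_nonneg (hR.trans ha).le _
      _ = _ := by
          rw [integral_Ioi_rpow_of_lt (by norm_num) hR]
          congr 1
          norm_num
          rw [Real.rpow_neg_one]
  rw [h]
  calc _ ≤ 2 * ENNReal.ofReal R⁻¹ := by gcongr
    _ = _ := by
      rw [show (2 : ℝ≥0∞) = ENNReal.ofReal 2 by simp, ← ENNReal.ofReal_mul (by norm_num)]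

theorem lintegral_abs_rpow_mul_le_of_le {G : ℝ → ℝ≥0∞} (hG : Measurable G)
    (hG1 : ∫⁻ t, G t ^ (8 / 7 : ℝ) ≤ 1) (x : ℝ≥0∞) (s : ℝ) :
    ∫⁻ t, ENNReal.ofReal (|t - s| ^ (-(1 / 4) : ℝ)) * x * (if G t ≤ x then G t else 0) ≤
      5 * x ^ (8 / 7 : ℝ) := by
  rcases eq_or_ne x 0 with rfl | hx0
  · simp
  rcases eq_or_ne x ⊤ with rfl | hxt
  · rw [ENNReal.top_rpow_of_pos (by norm_num), ENNReal.mul_top (by norm_num)]; exact le_top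
  obtain ⟨r, rfl⟩ : ∃ r : ℝ, x = ENNReal.ofReal r := ⟨x.toReal, (ENNReal.ofReal_toReal hxt).symm⟩
  have hr : 0 < r := by simpa using hx0
  set R : ℝ := r ^ (-(8 / 7) : ℝ) with hRdef
  have hR : 0 < R := by positivity
  set k₁ : ℝ → ℝ≥0∞ := fun t => ENNReal.ofReal (if |t| < R then |t| ^ (-(1 / 4) : ℝ) else 0)
  set k₂ : ℝ → ℝ≥0∞ := fun t => ENNReal.ofReal (if R ≤ |t| then |t| ^ (-(1 / 4) : ℝ) else 0)
  have hk₁ : Measurable k₁ :=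
    (Measurable.ite (measurableSet_lt (by fun_prop) (by fun_prop)) (by fun_prop)
      (by fun_prop)).ennreal_ofReal
  have hk₂ : Measurable k₂ :=
    (Measurable.ite (measurableSet_le (by fun_prop) (by fun_prop)) (by fun_prop)
      (by fun_prop)).ennreal_ofReal
  have hpt : ∀ t, ENNReal.ofReal (|t - s| ^ (-(1 / 4) : ℝ)) * ENNReal.ofReal r *
      (if G t ≤ ENNReal.ofReal r then G t else 0) ≤
      ENNReal.ofReal r * ENNReal.ofReal r * k₁ (t - s) + ENNReal.ofReal r * (k₂ (t - s) * G t) := by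
    intro t
    rcases lt_or_ge |t - s| R with h | h
    · refine le_trans ?_ (le_add_right le_rfl)
      simp only [k₁, if_pos h]
      rw [mul_assoc, mul_comm]
      gcongr
      split_ifs with h'
      · exact h'
      · exact zero_le
    · refine le_trans ?_ (le_add_left le_rfl)
      simp only [k₂, if_pos h]
      rw [mul_comm (ENNReal.ofReal (|t - s| ^ _)), mul_assoc]
      gcongr
      split_ifs with h'
      · exact le_rfl
      · exact zero_le
  have hks : Measurable fun t => k₂ (t - s) := hk₂.comp (measurable_id.sub_const s)
  calc _ ≤ _ := lintegral_mono hpt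
    _ = ENNReal.ofReal r * ENNReal.ofReal r * (∫⁻ t, k₁ t) +
        ENNReal.ofReal r * ∫⁻ t, ((fun t => k₂ (t - s)) * G) t := by
      rw [lintegral_add_left (by fun_prop), lintegral_const_mul _ (by fun_prop),
        lintegral_const_mul' _ _ ENNReal.ofReal_ne_top, lintegral_sub_right_eq_self k₁ s]
      rfl
    _ ≤ ENNReal.ofReal r * ENNReal.ofReal r * ENNReal.ofReal (8 / 3 * R ^ (3 / 4 : ℝ)) +
        ENNReal.ofReal r * ENNReal.ofReal (2 * R ^ (-(1 / 8) : ℝ)) := by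
      gcongr
      · exact lintegral_indicator_lt_abs_rpow_le hR
      · calc _ ≤ (∫⁻ t, k₂ (t - s) ^ (8 : ℝ)) ^ (1 / 8 : ℝ) *
              (∫⁻ t, G t ^ (8 / 7 : ℝ)) ^ (1 / (8 / 7) : ℝ) :=
              ENNReal.lintegral_mul_le_Lp_mul_Lq volume
              (⟨by norm_num, by norm_num, by norm_num⟩ : Real.HolderConjugate 8 (8 / 7))
              hks.aemeasurable hG.aemeasurable
          _ ≤ (ENNReal.ofReal (2 * R⁻¹)) ^ (1 / 8 : ℝ) * 1 := by
              gcongr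
              · rw [lintegral_sub_right_eq_self (fun t => k₂ t ^ (8 : ℝ)) s]
                exact lintegral_indicator_ge_abs_rpow_le hR
              · exact ENNReal.rpow_le_one hG1 (by norm_num)
          _ ≤ _ := by
              rw [mul_one, ENNReal.ofReal_rpow_of_nonneg (by positivity) (by norm_num)]
              apply ENNReal.ofReal_le_ofReal
              rw [Real.mul_rpow (by norm_num) (by positivity), Real.inv_rpow hR.le,
                Real.rpow_neg hR.le]
              gcongr
              calc (2 : ℝ) ^ (1 / 8 : ℝ) ≤ 2 ^ (1 : ℝ) :=
                    Real.rpow_le_rpow_of_exponent_le (by norm_num) (by norm_num)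
                _ = 2 := by norm_num
    _ = ENNReal.ofReal (14 / 3 * r ^ (8 / 7 : ℝ)) := by
      rw [← ENNReal.ofReal_mul hr.le, ← ENNReal.ofReal_mul (by positivity),
        ← ENNReal.ofReal_mul (by positivity), ← ENNReal.ofReal_add (by positivity) (by positivity)]
      congr 1
      rw [hRdef, ← Real.rpow_mul hr.le, ← Real.rpow_mul hr.le]
      have e1 : r ^ (8 / 7 : ℝ) = r * r * r ^ (-(8 / 7) * (3 / 4) : ℝ) := by
        nth_rw 2 [← Real.rpow_one r]
        nth_rw 3 [← Real.rpow_one r]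
        rw [← Real.rpow_add hr, ← Real.rpow_add hr]; norm_num
      have e2 : r ^ (8 / 7 : ℝ) = r * r ^ (-(8 / 7) * (-(1 / 8)) : ℝ) := by
        nth_rw 2 [← Real.rpow_one r]
        rw [← Real.rpow_add hr]; norm_num
      linear_combination (-8 / 3) * e1 - 2 * e2
    _ ≤ _ := by
      rw [ENNReal.ofReal_rpow_of_nonneg hr.le (by norm_num),
        show (5 : ℝ≥0∞) = ENNReal.ofReal 5 by simp, ← ENNReal.ofReal_mul (by norm_num)]
      apply ENNReal.ofReal_le_ofReal
      gcongr
      norm_num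

theorem lintegral_lintegral_abs_rpow_mul_le_of_le_one {F G : ℝ → ℝ≥0∞} (hF : Measurable F)
    (hG : Measurable G) (hF1 : ∫⁻ t, F t ^ (8 / 7 : ℝ) ≤ 1) (hG1 : ∫⁻ t, G t ^ (8 / 7 : ℝ) ≤ 1) :
    ∫⁻ t, ∫⁻ s, ENNReal.ofReal (|t - s| ^ (-(1 / 4) : ℝ)) * F s * G t ≤ 10 := by
  have half : ∀ {F G : ℝ → ℝ≥0∞}, Measurable G → ∫⁻ t, F t ^ (8 / 7 : ℝ) ≤ 1 →
      ∫⁻ t, G t ^ (8 / 7 : ℝ) ≤ 1 →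
      ∫⁻ s, ∫⁻ t, ENNReal.ofReal (|t - s| ^ (-(1 / 4) : ℝ)) * F s *
        (if G t ≤ F s then G t else 0) ≤ 5 := by
    intro F G hG hF1 hG1
    calc _ ≤ ∫⁻ s, 5 * F s ^ (8 / 7 : ℝ) :=
          lintegral_mono fun s => lintegral_abs_rpow_mul_le_of_le hG hG1 (F s) s
      _ = 5 * ∫⁻ s, F s ^ (8 / 7 : ℝ) := lintegral_const_mul' _ _ (by norm_num)
      _ ≤ 5 * 1 := by gcongr
      _ = 5 := mul_one _
  have hle : Measurable fun p : ℝ × ℝ =>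
      ENNReal.ofReal (|p.1 - p.2| ^ (-(1 / 4) : ℝ)) * F p.2 * (if G p.1 ≤ F p.2 then G p.1 else 0) := by
    apply Measurable.mul (by fun_prop)
    exact Measurable.ite (measurableSet_le (by fun_prop) (by fun_prop)) (by fun_prop) (by fun_prop)
  calc _ ≤ ∫⁻ t, ∫⁻ s, (ENNReal.ofReal (|t - s| ^ (-(1 / 4) : ℝ)) * F s *
          (if G t ≤ F s then G t else 0) + ENNReal.ofReal (|s - t| ^ (-(1 / 4) : ℝ)) * G t *
          (if F s ≤ G t then F s else 0)) := by
        apply lintegral_mono; intro t; apply lintegral_mono; intro s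
        simp only
        rcases le_total (G t) (F s) with h | h
        · rw [if_pos h]; exact le_add_right le_rfl
        · rw [if_pos h, abs_sub_comm s t]
          refine le_trans (le_of_eq ?_) (le_add_left le_rfl)
          ring
    _ = (∫⁻ t, ∫⁻ s, ENNReal.ofReal (|t - s| ^ (-(1 / 4) : ℝ)) * F s *
          (if G t ≤ F s then G t else 0)) + ∫⁻ t, ∫⁻ s, ENNReal.ofReal (|s - t| ^ (-(1 / 4) : ℝ)) * G t *
          (if F s ≤ G t then F s else 0) := by
        rw [← lintegral_add_left hle.lintegral_prod_right']
        congr 1; ext t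
        exact lintegral_add_left (hle.comp measurable_prodMk_left) _
    _ ≤ 5 + 5 := by
        gcongr
        · rw [lintegral_lintegral_swap hle.aemeasurable]
          exact half hG hF1 hG1
        · exact half hF hG1 hF1
    _ = 10 := by norm_num

/-- The diagonal Hardy–Littlewood–Sobolev inequality on the line for the kernel `|t - s|^{-1/4}`. -/
theorem lintegral_lintegral_abs_rpow_mul_le {F G : ℝ → ℝ≥0∞} (hF : Measurable F)
    (hG : Measurable G) (hFt : ∫⁻ t, F t ^ (8 / 7 : ℝ) ≠ ⊤) (hGt : ∫⁻ t, G t ^ (8 / 7 : ℝ) ≠ ⊤) :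
    ∫⁻ t, ∫⁻ s, ENNReal.ofReal (|t - s| ^ (-(1 / 4) : ℝ)) * F s * G t ≤
      10 * (∫⁻ t, F t ^ (8 / 7 : ℝ)) ^ (7 / 8 : ℝ) * (∫⁻ t, G t ^ (8 / 7 : ℝ)) ^ (7 / 8 : ℝ) := by
  set p := ∫⁻ t, F t ^ (8 / 7 : ℝ) with hp
  set q := ∫⁻ t, G t ^ (8 / 7 : ℝ) with hq
  have ae0 : ∀ {F : ℝ → ℝ≥0∞}, Measurable F → ∫⁻ t, F t ^ (8 / 7 : ℝ) = 0 → F =ᵐ[volume] 0 := by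
    intro F hF h
    rw [lintegral_eq_zero_iff (hF.pow_const _)] at h
    filter_upwards [h] with x hx
    exact (ENNReal.rpow_eq_zero_iff_of_pos (by norm_num)).1 hx
  rcases eq_or_ne p 0 with hp0 | hp0
  · have : ∀ t, ∫⁻ s, ENNReal.ofReal (|t - s| ^ (-(1 / 4) : ℝ)) * F s * G t = 0 := by
      intro t
      rw [lintegral_congr_ae (g := fun _ => 0)]
      · simp
      · filter_upwards [ae0 hF hp0] with s hs; simp [hs]
    simp only [this]
    simp
  rcases eq_or_ne q 0 with hq0 | hq0
  · rw [lintegral_congr_ae (g := fun _ => 0)]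
    · simp
    · filter_upwards [ae0 hG hq0] with s hs; simp [hs]
  have norm1 : ∀ {F : ℝ → ℝ≥0∞} {p : ℝ≥0∞}, Measurable F → p = ∫⁻ t, F t ^ (8 / 7 : ℝ) → p ≠ 0 →
      p ≠ ⊤ → ∫⁻ t, ((p ^ (7 / 8 : ℝ))⁻¹ * F t) ^ (8 / 7 : ℝ) ≤ 1 := by
    intro F p hF hp h0 ht
    simp_rw [ENNReal.mul_rpow_of_nonneg _ _ (show (0 : ℝ) ≤ 8 / 7 by norm_num)]
    rw [lintegral_const_mul _ (hF.pow_const _), ← hp, ← ENNReal.rpow_neg, ← ENNReal.rpow_mul]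
    norm_num
    rw [ENNReal.rpow_neg_one, ENNReal.inv_mul_cancel h0 ht]
  have key := lintegral_lintegral_abs_rpow_mul_le_of_le_one (hF.const_mul (p ^ (7 / 8 : ℝ))⁻¹)
    (hG.const_mul (q ^ (7 / 8 : ℝ))⁻¹) (norm1 hF hp hp0 hFt) (norm1 hG hq hq0 hGt)
  set a := p ^ (7 / 8 : ℝ) with ha
  set b := q ^ (7 / 8 : ℝ) with hb
  have ha0 : a ≠ 0 := fun h => hp0 ((ENNReal.rpow_eq_zero_iff_of_pos (by norm_num)).1 h)
  have hb0 : b ≠ 0 := fun h => hq0 ((ENNReal.rpow_eq_zero_iff_of_pos (by norm_num)).1 h)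
  have hat : a ≠ ⊤ := ENNReal.rpow_ne_top_of_nonneg (by norm_num) hFt
  have hbt : b ≠ ⊤ := ENNReal.rpow_ne_top_of_nonneg (by norm_num) hGt
  have e : ∫⁻ t, ∫⁻ s, ENNReal.ofReal (|t - s| ^ (-(1 / 4) : ℝ)) * F s * G t =
      (a * b) * ∫⁻ t, ∫⁻ s, ENNReal.ofReal (|t - s| ^ (-(1 / 4) : ℝ)) * (a⁻¹ * F s) * (b⁻¹ * G t) := by
    rw [← lintegral_const_mul' _ _ (ENNReal.mul_ne_top hat hbt)]
    congr 1; ext t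
    rw [← lintegral_const_mul' _ _ (ENNReal.mul_ne_top hat hbt)]
    congr 1; ext s
    calc _ = (a * a⁻¹) * (b * b⁻¹) * (ENNReal.ofReal (|t - s| ^ (-(1 / 4) : ℝ)) * F s * G t) := by
          rw [ENNReal.mul_inv_cancel ha0 hat, ENNReal.mul_inv_cancel hb0 hbt]; simp
      _ = _ := by ring
  rw [e]
  calc _ ≤ a * b * 10 := by gcongr
    _ = _ := by ring
end

theorem norm_integral_exp_neg_mul_le {q : ℝ → ℝ} {θ : ℝ → ℂ} {K : ℝ} (hq : Measurable q)
    (hθ : Measurable θ) (hθ1 : ∀ x, ‖θ x‖ = 1)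
    (hi : Integrable fun x => if 0 < q x then Real.exp (-q x) else 0)
    (hK : ∀ r, ‖∫ x in {x | 0 < q x ∧ q x < r}, θ x‖ ≤ K) :
    ‖∫ x, if 0 < q x then (Real.exp (-q x) : ℂ) * θ x else 0‖ ≤ K := by
  set S : ℝ → Set ℝ := fun x => if 0 < q x then Set.Ioi (q x) else ∅ with hS
  set P : ℝ × ℝ → ℂ := fun p =>
    if 0 < q p.1 ∧ q p.1 < p.2 then (Real.exp (-p.2) : ℂ) * θ p.1 else 0 with hP
  have hPm : Measurable P := by
    have h1 : Measurable fun p : ℝ × ℝ => q p.1 := hq.comp measurable_fst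
    exact Measurable.ite ((measurableSet_lt measurable_const h1).inter
      (measurableSet_lt h1 measurable_snd)) (by fun_prop) measurable_const
  have hPs : ∀ x, (fun r => P (x, r)) =
      (S x).indicator (fun r => (Real.exp (-r) : ℂ) * θ x) := by
    intro x; ext r
    by_cases h : 0 < q x <;> by_cases h' : q x < r <;> simp [hP, hS, h, h']
  have hie : ∀ c : ℝ, IntegrableOn (fun r : ℝ => Real.exp (-r)) (Set.Ioi c) := by
    intro c; simpa using integrableOn_exp_neg_Ioi c
  have hPn : ∀ x, (fun r => ‖P (x, r)‖) = (S x).indicator (fun r => Real.exp (-r)) := by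
    intro x; ext r
    by_cases h : 0 < q x <;> by_cases h' : q x < r <;> simp [hP, hS, h, h', hθ1, Complex.norm_exp]
  have hSm : ∀ x, MeasurableSet (S x) := by
    intro x; simp only [hS]; split_ifs <;> measurability
  have hPi : Integrable P (volume.prod volume) := by
    rw [integrable_prod_iff hPm.aestronglyMeasurable]
    refine ⟨Filter.Eventually.of_forall fun x => ?_, ?_⟩
    · rw [hPs, integrable_indicator_iff (hSm x)]
      simp only [hS]
      split_ifs
      · exact ((hie _).ofReal).mul_const _
      · exact integrableOn_empty
    · refine hi.congr (Filter.Eventually.of_forall fun x => ?_)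
      simp only
      rw [hPn, integral_indicator (hSm x)]
      simp only [hS]
      split_ifs
      · rw [integral_exp_neg_Ioi]
      · simp
  have e1 : ∀ x, ∫ r, P (x, r) = if 0 < q x then (Real.exp (-q x) : ℂ) * θ x else 0 := by
    intro x
    rw [hPs, integral_indicator (hSm x)]
    simp only [hS]
    split_ifs
    · rw [integral_mul_const, integral_complex_ofReal, integral_exp_neg_Ioi]
    · simp
  have e2 : ∀ r, ∫ x, P (x, r) = (Real.exp (-r) : ℂ) * ∫ x in {x | 0 < q x ∧ q x < r}, θ x := by
    intro r
    rw [← integral_const_mul, ← integral_indicator]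
    · congr 1; ext x
      simp [hP, Set.indicator_apply]
    · exact (measurableSet_lt measurable_const hq).inter (measurableSet_lt hq measurable_const)
  calc _ = ‖∫ x, ∫ r, P (x, r)‖ := by simp_rw [e1]
    _ = ‖∫ r, ∫ x, P (x, r)‖ := by
      rw [integral_integral_swap (f := fun x r => P (x, r)) hPi]
    _ ≤ ∫ r, (Set.Ioi (0 : ℝ)).indicator (fun r => Real.exp (-r) * K) r := by
      apply norm_integral_le_of_norm_le
      · rw [integrable_indicator_iff measurableSet_Ioi]; exact (hie 0).mul_const K
      · refine Filter.Eventually.of_forall fun r => ?_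
        rw [e2]
        by_cases hr : 0 < r
        · rw [Set.indicator_of_mem (show r ∈ Set.Ioi 0 from hr), norm_mul, Complex.norm_real,
            Real.norm_of_nonneg (Real.exp_pos _).le]
          gcongr
          exact hK r
        · have : {x | 0 < q x ∧ q x < r} = ∅ := by
            ext x; simp; intro h; linarith
          rw [Set.indicator_of_notMem (show r ∉ Set.Ioi 0 from hr), this]; simp
    _ = K := by
      rw [integral_indicator measurableSet_Ioi, integral_mul_const, integral_exp_neg_Ioi]; simp

theorem norm_setIntegral_sq_mem_Ioo_le {θ : ℝ → ℂ} {K : ℝ} (hθ : Continuous θ)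
    (hK : ∀ a b, a ≤ b → ‖∫ x in a..b, θ x‖ ≤ K) (A B : ℝ) :
    ‖∫ x in {x : ℝ | A < x ^ 2 ∧ x ^ 2 < B}, θ x‖ ≤ 2 * K := by
  have hK0 : 0 ≤ K := (norm_nonneg _).trans (hK 0 0 le_rfl)
  have hI : ∀ a b, ‖∫ x in Set.Ioo a b, θ x‖ ≤ K := by
    intro a b
    rcases le_total a b with h | h
    · rw [← integral_Ioc_eq_integral_Ioo, ← intervalIntegral.integral_of_le h]; exact hK a b h
    · rw [Set.Ioo_eq_empty (not_lt.2 h)]; simpa using hK0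
  rcases lt_or_ge A 0 with hA | hA
  · have : {x : ℝ | A < x ^ 2 ∧ x ^ 2 < B} = Set.Ioo (-√B) (√B) := by
      ext x
      rw [Set.mem_ofPred_eq, Real.sq_lt, Set.mem_Ioo, and_iff_right]
      exact hA.trans_le (sq_nonneg x)
    rw [this]; linarith [hI (-√B) (√B)]
  · have : {x : ℝ | A < x ^ 2 ∧ x ^ 2 < B} = Set.Ioo (√A) (√B) ∪ Set.Ioo (-√B) (-√A) := by
      ext x
      have h0 := Real.sqrt_nonneg A
      have h1 := Real.sqrt_nonneg B
      rw [Set.mem_ofPred_eq, Real.sq_lt, Set.mem_union, Set.mem_Ioo, Set.mem_Ioo,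
        ← Real.sqrt_lt_sqrt_iff hA, Real.sqrt_sq_eq_abs, lt_abs]
      constructor
      · rintro ⟨h | h, h2, h3⟩
        · exact Or.inl ⟨h, h3⟩
        · exact Or.inr ⟨h2, by linarith⟩
      · rintro (⟨h2, h3⟩ | ⟨h2, h3⟩)
        · exact ⟨Or.inl h2, by linarith, h3⟩
        · exact ⟨Or.inr (by linarith), h2, by linarith⟩
    rw [this, setIntegral_union]
    · calc _ ≤ _ := norm_add_le _ _
        _ ≤ K + K := add_le_add (hI _ _) (hI _ _)
        _ = _ := by ring
    · rw [Set.disjoint_left]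
      rintro x ⟨h, _⟩ ⟨_, h'⟩
      linarith [Real.sqrt_nonneg A]
    · exact measurableSet_Ioo
    · exact (hθ.integrableOn_Icc).mono_set Set.Ioo_subset_Icc_self
    · exact (hθ.integrableOn_Icc).mono_set Set.Ioo_subset_Icc_self

noncomputable def carlemanRoot (l ξ : ℝ) : ℂ := 2 * Real.pi * ξ * Complex.I - l

/-- Real part of the cubed root. -/
noncomputable def carlemanRe (l ξ : ℝ) : ℝ := l * (12 * Real.pi ^ 2 * ξ ^ 2 - l ^ 2)

theorem carlemanRoot_pow (l ξ : ℝ) : carlemanRoot l ξ ^ 3 = (carlemanRe l ξ : ℂ) +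
    ((6 * Real.pi * l ^ 2 * ξ - (2 * Real.pi) ^ 3 * ξ ^ 3 : ℝ) : ℂ) * Complex.I := by
  simp only [carlemanRoot, carlemanRe]
  push_cast
  have h : Complex.I ^ 3 = - Complex.I := Complex.I_pow_three
  linear_combination (8 * Real.pi ^ 3 * ξ ^ 3 : ℂ) * h - (12 * Real.pi ^ 2 * ξ ^ 2 * l : ℂ) * Complex.I_sq

theorem continuous_carlemanRe (l : ℝ) : Continuous (carlemanRe l) := by
  unfold carlemanRe; fun_prop

theorem continuous_carlemanRoot (l : ℝ) : Continuous (carlemanRoot l) := by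
  unfold carlemanRoot; fun_prop

/-- The fundamental solution of `∂_s + z³`, decaying in the direction selected by the sign of `Re z³`. -/
noncomputable def carlemanMul (l τ ξ : ℝ) : ℂ :=
  if 0 < τ * carlemanRe l ξ then (Real.sign τ : ℂ) * Complex.exp (-(τ * carlemanRoot l ξ ^ 3)) else 0

theorem measurable_carlemanMul (l : ℝ) : Measurable fun p : ℝ × ℝ => carlemanMul l p.1 p.2 := by
  have h1 : Measurable fun p : ℝ × ℝ => carlemanRe l p.2 :=
    (continuous_carlemanRe l).measurable.comp measurable_snd
  have h2 : Measurable fun p : ℝ × ℝ => carlemanRoot l p.2 :=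
    (continuous_carlemanRoot l).measurable.comp measurable_snd
  have h3 : Measurable Real.sign := by
    unfold Real.sign
    exact Measurable.ite (measurableSet_lt measurable_id measurable_const) measurable_const
      (Measurable.ite (measurableSet_lt measurable_const measurable_id) measurable_const
        measurable_const)
  have h4 : Measurable fun p : ℝ × ℝ => (Real.sign p.1 : ℂ) :=
    Complex.measurable_ofReal.comp (h3.comp measurable_fst)
  have h5 : Measurable fun p : ℝ × ℝ => (p.1 : ℂ) := Complex.measurable_ofReal.comp measurable_fst
  exact Measurable.ite (measurableSet_lt measurable_const (measurable_fst.mul h1))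
    (h4.mul (((h5.mul (h2.pow_const 3)).neg).cexp)) measurable_const

theorem norm_carlemanMul {l τ ξ : ℝ} : ‖carlemanMul l τ ξ‖ =
    if 0 < τ * carlemanRe l ξ then Real.exp (-(τ * carlemanRe l ξ)) else 0 := by
  unfold carlemanMul
  split_ifs with h
  · have hτ : τ ≠ 0 := by rintro rfl; simp at h
    have : ‖(Real.sign τ : ℂ)‖ = 1 := by
      rcases Real.sign_apply_eq_of_ne_zero τ hτ with h | h <;> simp [h]
    rw [norm_mul, this, one_mul, Complex.norm_exp, carlemanRoot_pow, Complex.neg_re,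
      Complex.re_ofReal_mul, Complex.add_re, Complex.re_ofReal_mul]
    simp
  · simp

theorem norm_carlemanMul_le (l τ ξ : ℝ) : ‖carlemanMul l τ ξ‖ ≤ 1 := by
  rw [norm_carlemanMul]
  split_ifs with h
  · exact Real.exp_le_one_iff.2 (by linarith)
  · norm_num

theorem integrable_carlemanMul {l τ : ℝ} (hl : l ≠ 0) (hτ : τ ≠ 0) :
    Integrable (carlemanMul l τ) := by
  have hm : AEStronglyMeasurable (carlemanMul l τ) :=
    ((measurable_carlemanMul l).comp measurable_prodMk_left).aestronglyMeasurable
  rcases lt_or_gt_of_ne (mul_ne_zero hτ hl) with h | h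
  · have hi : Integrable ((Set.Icc (-|l|) |l|).indicator fun _ : ℝ => (1 : ℝ)) := by
      rw [integrable_indicator_iff measurableSet_Icc]
      exact integrableOn_const (by simp)
    refine hi.mono' hm (Filter.Eventually.of_forall fun ξ => ?_)
    by_cases hx : 0 < τ * carlemanRe l ξ
    · rw [Set.indicator_of_mem]
      · exact norm_carlemanMul_le _ _ _
      · rw [Set.mem_Icc, ← abs_le, ← sq_le_sq]
        have h1 : 12 * Real.pi ^ 2 * ξ ^ 2 - l ^ 2 < 0 := by
          unfold carlemanRe at hx
          rw [← mul_assoc] at hx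
          by_contra! h2
          nlinarith
        have : 1 ≤ 12 * Real.pi ^ 2 := by nlinarith [Real.pi_gt_three]
        nlinarith [sq_nonneg ξ]
    · rw [norm_carlemanMul, if_neg hx]
      exact Set.indicator_nonneg (by simp) _
  · have hi : Integrable fun ξ : ℝ => Real.exp (τ * l ^ 3) *
        Real.exp (-(τ * l * 12 * Real.pi ^ 2) * ξ ^ 2) :=
      (integrable_exp_neg_mul_sq (by positivity)).const_mul _
    refine hi.mono' hm (Filter.Eventually.of_forall fun ξ => ?_)
    rw [norm_carlemanMul, ← Real.exp_add]
    split_ifs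
    · apply le_of_eq
      congr 1
      unfold carlemanRe; ring
    · positivity

open FourierTransform in
theorem norm_fourier_carlemanMul_le {l τ : ℝ} (hl : l ≠ 0) (hτ : τ ≠ 0) (x : ℝ) :
    ‖𝓕 (carlemanMul l τ) x‖ ≤ 28 * |τ| ^ (-(1 / 3) : ℝ) := by
  set σ : ℝ := (2 * Real.pi) ^ 3 * τ with hσ
  set y : ℝ := -(6 * Real.pi * l ^ 2 * τ + 2 * Real.pi * x) with hy
  set θ : ℝ → ℂ := fun ξ => Complex.exp (Complex.I * ((σ * ξ ^ 3 + y * ξ : ℝ) : ℂ)) with hθ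
  have hθc : Continuous θ := by simp only [hθ]; fun_prop
  set q : ℝ → ℝ := fun ξ => τ * carlemanRe l ξ with hq
  have hqc : Continuous q := continuous_const.mul (continuous_carlemanRe l)
  have hσ0 : σ ≠ 0 := by simp only [hσ]; positivity
  have hK := norm_setIntegral_sq_mem_Ioo_le hθc
    (fun a b hab => norm_integral_exp_mul_cubic_le y hab hσ0)
  have hKr : ∀ r, ‖∫ ξ in {ξ | 0 < q ξ ∧ q ξ < r}, θ ξ‖ ≤ 2 * (14 * |σ| ^ (-(1 / 3) : ℝ)) := by
    intro r
    set α : ℝ := 12 * Real.pi ^ 2 with hα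
    have hα0 : 0 < α := by positivity
    rcases lt_or_gt_of_ne (mul_ne_zero hτ hl) with h | h
    · have : {ξ | 0 < q ξ ∧ q ξ < r} =
          {ξ | (l ^ 2 + r / (τ * l)) / α < ξ ^ 2 ∧ ξ ^ 2 < l ^ 2 / α} := by
        ext ξ
        simp only [Set.mem_ofPred_eq, hq, carlemanRe, ← hα]
        have hneg : ∀ b : ℝ, 0 < τ * l * b ↔ b < 0 := fun b =>
          ⟨fun h' => by by_contra! h2; nlinarith, mul_pos_of_neg_of_neg h⟩
        rw [div_lt_iff₀ hα0, lt_div_iff₀ hα0, ← mul_assoc, hneg]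
        rw [← lt_sub_iff_add_lt', div_lt_iff_of_neg h, and_comm]
        constructor <;> rintro ⟨h1, h2⟩ <;> constructor <;> linarith
      rw [this]; exact hK _ _
    · have : {ξ | 0 < q ξ ∧ q ξ < r} =
          {ξ | l ^ 2 / α < ξ ^ 2 ∧ ξ ^ 2 < (l ^ 2 + r / (τ * l)) / α} := by
        ext ξ
        simp only [Set.mem_ofPred_eq, hq, carlemanRe, ← hα]
        rw [div_lt_iff₀ hα0, lt_div_iff₀ hα0, ← mul_assoc, mul_pos_iff_of_pos_left h]
        rw [← sub_lt_iff_lt_add', lt_div_iff₀ h]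
        constructor <;> rintro ⟨h1, h2⟩ <;> constructor <;> linarith
      rw [this]; exact hK _ _
  have hqi : Integrable fun ξ => if 0 < q ξ then Real.exp (-q ξ) else 0 := by
    refine (integrable_carlemanMul hl hτ).norm.congr (Filter.Eventually.of_forall fun ξ => ?_)
    exact norm_carlemanMul
  have main := norm_integral_exp_neg_mul_le hqc.measurable hθc.measurable
    (fun ξ => by simp only [hθ]; rw [mul_comm]; exact Complex.norm_exp_ofReal_mul_I _) hqi hKr
  have e : 𝓕 (carlemanMul l τ) x = (Real.sign τ : ℂ) *
      ∫ ξ, if 0 < q ξ then (Real.exp (-q ξ) : ℂ) * θ ξ else 0 := by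
    rw [Real.fourier_real_eq_integral_exp_smul, ← integral_const_mul]
    congr 1; ext ξ
    simp only [carlemanMul, hq]
    split_ifs
    · rw [smul_eq_mul, mul_left_comm, ← Complex.exp_add]
      simp only [hθ]
      rw [Complex.ofReal_exp, ← Complex.exp_add, carlemanRoot_pow]
      congr 2
      simp only [hσ, hy]
      push_cast
      ring
    · simp
  have hs : ‖(Real.sign τ : ℂ)‖ = 1 := by
    rcases Real.sign_apply_eq_of_ne_zero τ hτ with h | h <;> simp [h]
  rw [e, norm_mul, hs, one_mul]
  refine main.trans ?_
  have : |σ| ^ (-(1 / 3) : ℝ) ≤ |τ| ^ (-(1 / 3) : ℝ) := by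
    apply Real.rpow_le_rpow_of_nonpos (abs_pos.2 hτ) _ (by norm_num)
    rw [hσ, abs_mul]
    have : 1 ≤ |(2 * Real.pi) ^ 3| := by
      rw [abs_of_pos (by positivity)]
      exact one_le_pow₀ (by linarith [Real.pi_gt_three])
    nlinarith [abs_nonneg τ]
  linarith

/-- The Fourier transform of `e^{lx} u`, as a Laplace transform. -/
noncomputable def carlemanLaplace (l : ℝ) (u : ℝ → ℝ) (ξ : ℝ) : ℂ :=
  ∫ x : ℝ, Complex.exp (-(carlemanRoot l ξ * x)) * u x

open FourierTransform in
theorem fourier_exp_mul (l : ℝ) (u : ℝ → ℝ) (ξ : ℝ) :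
    𝓕 (fun x => ((Real.exp (l * x) * u x : ℝ) : ℂ)) ξ = carlemanLaplace l u ξ := by
  rw [Real.fourier_real_eq_integral_exp_smul, carlemanLaplace]
  congr 1; ext x
  rw [smul_eq_mul, Complex.ofReal_mul (Real.exp _), ← mul_assoc, Complex.ofReal_exp, ← Complex.exp_add]
  congr 2
  simp only [carlemanRoot]
  push_cast
  ring

theorem hasDerivAt_cexp_neg_mul (z : ℂ) (x : ℝ) : HasDerivAt (fun x : ℝ => Complex.exp (-(z * x)))
    (-z * Complex.exp (-(z * x))) x := by
  have h := (((hasDerivAt_id x).ofReal_comp.const_mul z).neg).cexp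
  simp only [id] at h
  convert! h using 1
  simp only [Pi.neg_apply, Complex.ofReal_one, mul_one]
  ring

theorem hasCompactSupport_of_forall_abs {E : Type*} [Zero E] {u : ℝ → E} {M : ℝ}
    (h : ∀ x, M < |x| → u x = 0) : HasCompactSupport u := by
  refine HasCompactSupport.intro (isCompact_Icc (a := -M) (b := M)) fun x hx => h x ?_
  rw [Set.mem_Icc, ← abs_le] at hx
  exact not_le.1 hx

theorem integrable_cexp_neg_mul_mul {M : ℝ} {u : ℝ → ℝ} (hu : Continuous u)
    (hs : ∀ x, M < |x| → u x = 0) (z : ℂ) :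
    Integrable fun x : ℝ => Complex.exp (-(z * x)) * u x := by
  apply Continuous.integrable_of_hasCompactSupport (by fun_prop)
  exact hasCompactSupport_of_forall_abs (M := M) fun x hx => by simp [hs x hx]

theorem carlemanLaplace_third_deriv {l M : ℝ} {u u₁ u₂ u₃ : ℝ → ℝ}
    (h₀ : ∀ x, HasDerivAt u (u₁ x) x) (h₁ : ∀ x, HasDerivAt u₁ (u₂ x) x)
    (h₂ : ∀ x, HasDerivAt u₂ (u₃ x) x) (h₃ : Continuous u₃)
    (s₀ : ∀ x, M < |x| → u x = 0) (s₁ : ∀ x, M < |x| → u₁ x = 0)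
    (s₂ : ∀ x, M < |x| → u₂ x = 0) (s₃ : ∀ x, M < |x| → u₃ x = 0) (ξ : ℝ) :
    carlemanLaplace l u₃ ξ = carlemanRoot l ξ ^ 3 * carlemanLaplace l u ξ := by
  set z := carlemanRoot l ξ with hz
  have c₀ : Continuous u := continuous_iff_continuousAt.2 fun x => (h₀ x).continuousAt
  have c₁ : Continuous u₁ := continuous_iff_continuousAt.2 fun x => (h₁ x).continuousAt
  have c₂ : Continuous u₂ := continuous_iff_continuousAt.2 fun x => (h₂ x).continuousAt
  have i₀ := integrable_cexp_neg_mul_mul c₀ s₀ z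
  have i₁ := integrable_cexp_neg_mul_mul c₁ s₁ z
  have i₂ := integrable_cexp_neg_mul_mul c₂ s₂ z
  have i₃ := integrable_cexp_neg_mul_mul h₃ s₃ z
  have hd : ∀ x : ℝ, HasDerivAt
      (fun x : ℝ => Complex.exp (-(z * x)) * u₂ x + z * (Complex.exp (-(z * x)) * u₁ x) +
        z ^ 2 * (Complex.exp (-(z * x)) * u x))
      (Complex.exp (-(z * x)) * u₃ x - z ^ 3 * (Complex.exp (-(z * x)) * u x)) x := by
    intro x
    have e := hasDerivAt_cexp_neg_mul z x
    have h := ((e.mul (h₂ x).ofReal_comp).add ((e.mul (h₁ x).ofReal_comp).const_mul z)).add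
      ((e.mul (h₀ x).ofReal_comp).const_mul (z ^ 2))
    convert! h using 1
    ring
  have := integral_eq_zero_of_hasDerivAt_of_integrable hd (i₃.sub (i₀.const_mul _))
    ((i₂.add (i₁.const_mul _)).add (i₀.const_mul _))
  rw [integral_sub i₃ (i₀.const_mul _), integral_const_mul, sub_eq_zero] at this
  exact this

theorem continuous_carlemanLaplace {l M : ℝ} {h : ℝ × ℝ → ℝ} (hc : Continuous h)
    (hs : ∀ p : ℝ × ℝ, M < |p.1| → h p = 0) :
    Continuous fun p : ℝ × ℝ => carlemanLaplace l (fun x => h (x, p.2)) p.1 := by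
  have h1 : Continuous fun p : ℝ × ℝ => ∫ x in Set.Icc (-M) M,
      Complex.exp (-(carlemanRoot l p.1 * x)) * h (x, p.2) := by
    apply continuous_parametric_integral_of_continuous _ isCompact_Icc
    have := continuous_carlemanRoot l
    simp only [Function.uncurry_def]
    fun_prop
  convert! h1 using 2 with p
  rw [carlemanLaplace, setIntegral_eq_integral_of_forall_compl_eq_zero]
  intro x hx
  rw [Set.mem_Icc, ← abs_le, not_le] at hx
  simp [hs (x, p.2) hx]

theorem hasDerivAt_carlemanLaplace {l M : ℝ} {g g' : ℝ × ℝ → ℝ}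
    (hgc : Continuous g) (hc : Continuous g') (hd : ∀ x t, HasDerivAt (fun t => g (x, t)) (g' (x, t)) t)
    (hgs : ∀ p : ℝ × ℝ, M < |p.1| → g p = 0)
    (hs : ∀ p : ℝ × ℝ, M < |p.1| → g' p = 0) (hK : HasCompactSupport g') (ξ t : ℝ) :
    HasDerivAt (fun t => carlemanLaplace l (fun x => g (x, t)) ξ)
      (carlemanLaplace l (fun x => g' (x, t)) ξ) t := by
  obtain ⟨C, hC⟩ := hc.bounded_above_of_compact_support hK
  set z := carlemanRoot l ξ with hz
  set b : ℝ → ℝ := (Set.Icc (-M) M).indicator fun x => ‖Complex.exp (-(z * x))‖ * C with hb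
  refine (hasDerivAt_integral_of_dominated_loc_of_deriv_le (bound := b) (s := Set.univ)
    (F' := fun t x => Complex.exp (-(z * x)) * g' (x, t)) Filter.univ_mem ?_ ?_ ?_ ?_ ?_ ?_).2
  · exact Filter.Eventually.of_forall fun t =>
      (integrable_cexp_neg_mul_mul (by fun_prop) (fun x hx => hgs (x, t) hx) z).1
  · exact integrable_cexp_neg_mul_mul (by fun_prop) (fun x hx => hgs (x, t) hx) z
  · exact (integrable_cexp_neg_mul_mul (by fun_prop) (fun x hx => hs (x, t) hx) z).1
  · refine Filter.Eventually.of_forall fun x t _ => ?_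
    by_cases hx : x ∈ Set.Icc (-M) M
    · rw [hb, Set.indicator_of_mem hx, norm_mul, Complex.norm_real]
      gcongr
      exact hC _
    · rw [hb, Set.indicator_of_notMem hx]
      rw [Set.mem_Icc, ← abs_le, not_le] at hx
      simp [hs (x, t) hx]
  · rw [hb, integrable_indicator_iff measurableSet_Icc]
    exact Continuous.integrableOn_Icc (by fun_prop)
  · exact Filter.Eventually.of_forall fun x t _ => (hd x t).ofReal_comp.const_mul _

/-- Duhamel's formula for compactly supported solutions, using the decaying direction. -/
theorem eq_integral_carlemanMul {l ξ : ℝ} (hR : carlemanRe l ξ ≠ 0) {F H : ℝ → ℂ}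
    (hd : ∀ t, HasDerivAt F (H t - carlemanRoot l ξ ^ 3 * F t) t) (hH : Continuous H)
    (hF0 : ∀ t, t ∉ Set.Icc (0 : ℝ) 1 → F t = 0) (hH0 : ∀ t, t ∉ Set.Icc (0 : ℝ) 1 → H t = 0) (t : ℝ) :
    F t = ∫ s, carlemanMul l (t - s) ξ * H s := by
  set w := carlemanRoot l ξ ^ 3 with hw
  have hwd : ∀ s : ℝ, HasDerivAt (fun s : ℝ => Complex.exp (-(-w * s)) * F s)
      (Complex.exp (-(-w * s)) * H s) s := by
    intro s
    convert! (hasDerivAt_cexp_neg_mul (-w) s).mul (hd s) using 1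
    ring
  have hwH : Integrable fun s : ℝ => Complex.exp (-(-w * s)) * H s := by
    apply Continuous.integrable_of_hasCompactSupport (by fun_prop)
    exact HasCompactSupport.intro isCompact_Icc fun s hs => by rw [hH0 s hs, mul_zero]
  have e : ∀ c : ℝ, Complex.exp (-(w * t)) * (Complex.exp (-(-w * t)) * c) = c := by
    intro c; rw [← mul_assoc, ← Complex.exp_add]; simp
  have e' : ∀ c : ℂ, Complex.exp (-(w * t)) * (Complex.exp (-(-w * t)) * c) = c := by
    intro c; rw [← mul_assoc, ← Complex.exp_add]; simp
  rcases lt_or_gt_of_ne hR with hR | hR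
  · have h1 : Filter.Tendsto (fun s : ℝ => Complex.exp (-(-w * s)) * F s) Filter.atTop (nhds 0) := by
      apply tendsto_const_nhds.congr'
      filter_upwards [Filter.eventually_gt_atTop 1] with s hs
      rw [hF0 s (fun h => absurd h.2 (not_le.2 hs)), mul_zero]
    have h2 := integral_Ioi_of_hasDerivAt_of_tendsto' (a := t) (fun s _ => hwd s)
      hwH.integrableOn h1
    have h3 : (fun s => carlemanMul l (t - s) ξ * H s) = (Set.Ioi t).indicator
        fun s => -Complex.exp (-(w * t)) * (Complex.exp (-(-w * s)) * H s) := by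
      ext s
      by_cases hs : t < s
      · rw [Set.indicator_of_mem (show s ∈ Set.Ioi t from hs), carlemanMul,
          if_pos (mul_pos_of_neg_of_neg (by linarith) hR), Real.sign_of_neg (by linarith),
          neg_mul, ← mul_assoc (Complex.exp _), ← Complex.exp_add, ← hw]
        push_cast
        rw [neg_one_mul, neg_mul]
        congr 3
        ring
      · rw [Set.indicator_of_notMem (show s ∉ Set.Ioi t from hs), carlemanMul, if_neg, zero_mul]
        nlinarith
    rw [h3, integral_indicator measurableSet_Ioi, integral_const_mul, h2, zero_sub, neg_mul_neg, e']
  · have h1 : Filter.Tendsto (fun s : ℝ => Complex.exp (-(-w * s)) * F s) Filter.atBot (nhds 0) := by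
      apply tendsto_const_nhds.congr'
      filter_upwards [Filter.eventually_lt_atBot 0] with s hs
      rw [hF0 s (fun h => absurd h.1 (not_le.2 hs)), mul_zero]
    have h2 := integral_Iic_of_hasDerivAt_of_tendsto' (a := t) (fun s _ => hwd s)
      hwH.integrableOn h1
    have h3 : (fun s => carlemanMul l (t - s) ξ * H s) = (Set.Iio t).indicator
        fun s => Complex.exp (-(w * t)) * (Complex.exp (-(-w * s)) * H s) := by
      ext s
      by_cases hs : s < t
      · rw [Set.indicator_of_mem (show s ∈ Set.Iio t from hs), carlemanMul,
          if_pos (mul_pos (by linarith) hR), Real.sign_of_pos (by linarith),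
          ← mul_assoc (Complex.exp _), ← Complex.exp_add, ← hw]
        push_cast
        rw [one_mul]
        congr 2
        ring
      · rw [Set.indicator_of_notMem (show s ∉ Set.Iio t from hs), carlemanMul, if_neg, zero_mul]
        nlinarith
    rw [h3, integral_indicator measurableSet_Iio, integral_const_mul, ← integral_Iic_eq_integral_Iio,
      h2, sub_zero, e']

open FourierTransform ENNReal in
theorem lintegral_enorm_fourier_sq {u : ℝ → ℂ} (h1 : Integrable u) (h2 : MemLp u 2 volume) :
    ∫⁻ x, ‖𝓕 u x‖ₑ ^ (2 : ℝ) = ∫⁻ x, ‖u x‖ₑ ^ (2 : ℝ) := by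
  have h := eLpNorm_fourier h1 h2
  rw [eLpNorm_eq_lintegral_rpow_enorm_toReal (by norm_num) (by norm_num),
    eLpNorm_eq_lintegral_rpow_enorm_toReal (by norm_num) (by norm_num)] at h
  simpa using ENNReal.rpow_left_injective (by norm_num) h

theorem integrable_norm_rpow_of_hasCompactSupport {u : ℝ → ℂ} (hc : Continuous u)
    (hs : HasCompactSupport u) {p : ℝ} (hp : 0 < p) : Integrable fun x => ‖u x‖ ^ p := by
  apply Continuous.integrable_of_hasCompactSupport (hc.norm.rpow_const fun _ => Or.inr hp.le)
  exact hs.comp_left (g := fun z : ℂ => ‖z‖ ^ p) (by simp [hp.ne'])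

theorem ae_carlemanRe_ne_zero {l : ℝ} (hl : l ≠ 0) : ∀ᵐ ξ : ℝ, carlemanRe l ξ ≠ 0 := by
  have hfin : {ξ : ℝ | carlemanRe l ξ = 0}.Finite := by
    apply (Set.toFinite {l / (√12 * Real.pi), -(l / (√12 * Real.pi))}).subset
    intro ξ hξ
    rw [Set.mem_ofPred_eq, carlemanRe, mul_eq_zero, or_iff_right hl] at hξ
    rw [Set.mem_insert_iff, Set.mem_singleton_iff]
    apply sq_eq_sq_iff_eq_or_eq_neg.1
    have h12 : √12 ^ 2 = (12 : ℝ) := Real.sq_sqrt (by norm_num)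
    rw [div_pow, mul_pow, h12, eq_div_iff (by positivity)]
    linarith
  filter_upwards [compl_mem_ae_iff.2 (hfin.measure_zero volume)] with ξ hξ using hξ

open FourierTransform ENNReal ComplexConjugate in
theorem integrable_prod_fourier_mul_carlemanMul {l t M : ℝ} {φ : ℝ → ℂ} {h : ℝ × ℝ → ℂ}
    (hφ : Continuous φ) (hφs : HasCompactSupport φ) (hh : Continuous h)
    (hs : ∀ p, p ∉ Set.Icc (-M) M ×ˢ Set.Icc (0 : ℝ) 1 → h p = 0)
    (hF : Continuous fun p : ℝ × ℝ => 𝓕 (fun x => h (x, p.2)) p.1) :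
    Integrable (fun p : ℝ × ℝ =>
      conj (𝓕 φ p.1) * (carlemanMul l (t - p.2) p.1 * 𝓕 (fun x => h (x, p.2)) p.1))
      (volume.prod volume) := by
  have hφi := hφ.integrable_of_hasCompactSupport hφs (μ := volume)
  have hφ2 : MemLp φ 2 volume := hφ.memLp_of_hasCompactSupport hφs
  have hsl : ∀ s, HasCompactSupport fun x => h (x, s) := fun s =>
    HasCompactSupport.intro isCompact_Icc fun x hx => hs (x, s) fun hp => hx hp.1
  have hslc : ∀ s, Continuous fun x => h (x, s) := fun s => by fun_prop
  have hφc : Continuous (𝓕 φ) := continuous_fourier_of_integrable hφi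
  have hm : Measurable fun p : ℝ × ℝ => carlemanMul l (t - p.2) p.1 :=
    (measurable_carlemanMul l).comp (f := fun p : ℝ × ℝ => (t - p.2, p.1)) (by fun_prop)
  refine ⟨((by fun_prop : Continuous fun p : ℝ × ℝ => conj (𝓕 φ p.1)).measurable.mul
    (hm.mul hF.measurable)).aestronglyMeasurable, ?_⟩
  rw [HasFiniteIntegral]
  have hzero : ∀ s, s ∉ Set.Icc (0 : ℝ) 1 → ∀ ξ, 𝓕 (fun x => h (x, s)) ξ = 0 := by
    intro s hs' ξ
    have : (fun x => h (x, s)) = fun _ => 0 := by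
      ext x; exact hs (x, s) fun hp => hs' hp.2
    rw [this, Real.fourier_eq]; simp
  set A : ℝ × ℝ → ℝ≥0∞ := fun p => (Set.Icc (0 : ℝ) 1).indicator 1 p.2 * ‖𝓕 φ p.1‖ₑ ^ (2 : ℝ) with hA
  set B : ℝ × ℝ → ℝ≥0∞ := fun p => ‖𝓕 (fun x => h (x, p.2)) p.1‖ₑ ^ (2 : ℝ) with hB
  have hAm : Measurable A :=
    ((measurable_one.indicator measurableSet_Icc).comp measurable_snd).mul
      ((hφc.measurable.comp measurable_fst).enorm.pow_const _)
  have hBm : Measurable B := hF.measurable.enorm.pow_const _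
  have hle : ∀ p : ℝ × ℝ, ‖conj (𝓕 φ p.1) *
      (carlemanMul l (t - p.2) p.1 * 𝓕 (fun x => h (x, p.2)) p.1)‖ₑ ≤ A p + B p := by
    rintro ⟨ξ, s⟩
    by_cases hs' : s ∈ Set.Icc (0 : ℝ) 1
    · simp only [hA, hB, Set.indicator_of_mem hs', Pi.one_apply, one_mul]
      simp only [← ofReal_norm]
      rw [ENNReal.ofReal_rpow_of_nonneg (norm_nonneg _) (by norm_num),
        ENNReal.ofReal_rpow_of_nonneg (norm_nonneg _) (by norm_num),
        ← ENNReal.ofReal_add (by positivity) (by positivity)]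
      apply ENNReal.ofReal_le_ofReal
      rw [norm_mul, norm_mul, RCLike.norm_conj, Real.rpow_two, Real.rpow_two]
      have h1 := norm_carlemanMul_le l (t - s) ξ
      have h2 : ‖carlemanMul l (t - s) ξ‖ * ‖𝓕 (fun x => h (x, s)) ξ‖ ≤ ‖𝓕 (fun x => h (x, s)) ξ‖ :=
        mul_le_of_le_one_left (norm_nonneg _) h1
      have h3 := mul_le_mul_of_nonneg_left h2 (norm_nonneg (𝓕 φ ξ))
      nlinarith [sq_nonneg (‖𝓕 φ ξ‖ - ‖𝓕 (fun x => h (x, s)) ξ‖), sq_nonneg ‖𝓕 φ ξ‖,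
        sq_nonneg ‖𝓕 (fun x => h (x, s)) ξ‖]
    · simp [hzero s hs']
  refine (lintegral_mono hle).trans_lt ?_
  rw [lintegral_add_left hAm]
  refine ENNReal.add_lt_top.2 ⟨?_, ?_⟩
  · rw [lintegral_prod_symm' _ hAm]
    simp only [hA]
    simp_rw [lintegral_const_mul _ (hφc.measurable.enorm.pow_const (2 : ℝ)),
      lintegral_enorm_fourier_sq hφi hφ2]
    have h2 := (integrable_norm_rpow_of_hasCompactSupport hφ hφs (p := 2) (by norm_num)).2
    have h3 : ∫⁻ x, ‖φ x‖ₑ ^ (2 : ℝ) < ⊤ := by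
      rw [HasFiniteIntegral] at h2
      convert h2 using 3 with x
      rw [Real.enorm_rpow_of_nonneg (norm_nonneg _) (by norm_num), enorm_norm]
    rw [lintegral_mul_const _ (measurable_one.indicator measurableSet_Icc),
      lintegral_indicator_one measurableSet_Icc]
    exact ENNReal.mul_lt_top (by simp) h3
  · rw [lintegral_prod_symm' _ hBm]
    simp only [hB]
    have h1 : ∀ s, ∫⁻ ξ, ‖𝓕 (fun x => h (x, s)) ξ‖ₑ ^ (2 : ℝ) = ∫⁻ x, ‖h (x, s)‖ₑ ^ (2 : ℝ) :=
      fun s => lintegral_enorm_fourier_sq ((hslc s).integrable_of_hasCompactSupport (hsl s))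
        ((hslc s).memLp_of_hasCompactSupport (hsl s))
    simp_rw [h1]
    rw [← lintegral_prod_symm' (fun p : ℝ × ℝ => ‖h p‖ₑ ^ (2 : ℝ)) (hh.measurable.enorm.pow_const _)]
    have hhs : HasCompactSupport h :=
      HasCompactSupport.intro (isCompact_Icc.prod isCompact_Icc) hs
    have := (hh.memLp_of_hasCompactSupport hhs (p := 2) (μ := volume.prod volume)).2
    have := lintegral_rpow_enorm_lt_top_of_eLpNorm_lt_top (by norm_num) (by norm_num) this
    simpa using this

open FourierTransform ENNReal ComplexConjugate in
theorem enorm_integral_conj_mul_le_of_duhamel {l t M : ℝ} (hl : l ≠ 0) {f φ : ℝ → ℂ}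
    {h : ℝ × ℝ → ℂ} (hf : Continuous f) (hfs : HasCompactSupport f)
    (hφ : Continuous φ) (hφs : HasCompactSupport φ) (hh : Continuous h)
    (hs : ∀ p, p ∉ Set.Icc (-M) M ×ˢ Set.Icc (0 : ℝ) 1 → h p = 0)
    (hF : Continuous fun p : ℝ × ℝ => 𝓕 (fun x => h (x, p.2)) p.1)
    (hrep : ∀ ξ, carlemanRe l ξ ≠ 0 →
      𝓕 f ξ = ∫ s, carlemanMul l (t - s) ξ * 𝓕 (fun x => h (x, s)) ξ) :
    ‖∫ x, conj (φ x) * f x‖ₑ ≤ ∫⁻ s, ENNReal.ofReal (|t - s| ^ (-(1 / 4) : ℝ)) *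
      (∫⁻ x, ‖h (x, s)‖ₑ ^ (8 / 7 : ℝ)) ^ (7 / 8 : ℝ) *
      (84 * (∫⁻ x, ‖φ x‖ₑ ^ (8 / 7 : ℝ)) ^ (7 / 8 : ℝ)) := by
  have hφi := hφ.integrable_of_hasCompactSupport hφs (μ := volume)
  have hφ2 : MemLp φ 2 volume := hφ.memLp_of_hasCompactSupport hφs
  have hsl : ∀ s, HasCompactSupport fun x => h (x, s) := fun s =>
    HasCompactSupport.intro isCompact_Icc fun x hx => hs (x, s) fun hp => hx hp.1
  have hslc : ∀ s, Continuous fun x => h (x, s) := fun s => by fun_prop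
  have e : ∫ x, conj (φ x) * f x = ∫ s, ∫ ξ,
      conj (𝓕 φ ξ) * (carlemanMul l (t - s) ξ * 𝓕 (fun x => h (x, s)) ξ) := by
    rw [← integral_conj_fourier_mul_fourier (hf.integrable_of_hasCompactSupport hfs)
      (hf.memLp_of_hasCompactSupport hfs) hφi hφ2,
      ← integral_integral_swap (f := fun ξ s =>
        conj (𝓕 φ ξ) * (carlemanMul l (t - s) ξ * 𝓕 (fun x => h (x, s)) ξ))
        (integrable_prod_fourier_mul_carlemanMul hφ hφs hh hs hF)]
    apply integral_congr_ae
    filter_upwards [ae_carlemanRe_ne_zero hl] with ξ hξ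
    rw [hrep ξ hξ, ← integral_const_mul]
  rw [e]
  refine (enorm_integral_le_lintegral_enorm _).trans ?_
  apply lintegral_mono_ae
  have hne : ∀ᵐ s : ℝ, s ≠ t := compl_mem_ae_iff.2 (measure_singleton (μ := volume) t)
  filter_upwards [hne] with s hst
  have hτ : t - s ≠ 0 := sub_ne_zero.2 hst.symm
  have hmi := integrable_carlemanMul hl hτ
  have hui := (hslc s).integrable_of_hasCompactSupport (hsl s) (μ := volume)
  have habs : 0 < |t - s| := abs_pos.2 hτ
  rw [integral_conj_fourier_mul hmi hui hφi]
  refine (enorm_integral_conj_mul_fourierMul_le hmi (norm_carlemanMul_le l _)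
    (norm_fourier_carlemanMul_le hl hτ) (hslc s).measurable hui
    ((hslc s).memLp_of_hasCompactSupport (hsl s))
    (integrable_norm_rpow_of_hasCompactSupport (hslc s) (hsl s) (by norm_num)) (by positivity)
    hφ.measurable).trans ?_
  have hc : ENNReal.ofReal (3 * (28 * |t - s| ^ (-(1 / 3) : ℝ)) ^ (3 / 4 : ℝ)) ≤
      84 * ENNReal.ofReal (|t - s| ^ (-(1 / 4) : ℝ)) := by
    rw [show (84 : ℝ≥0∞) = ENNReal.ofReal 84 by simp, ← ENNReal.ofReal_mul (by norm_num)]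
    apply ENNReal.ofReal_le_ofReal
    rw [Real.mul_rpow (by norm_num) (by positivity), ← Real.rpow_mul habs.le,
      show (-(1 / 3) * (3 / 4) : ℝ) = -(1 / 4) by norm_num, ← mul_assoc]
    gcongr
    have : (28 : ℝ) ^ (3 / 4 : ℝ) ≤ 28 ^ (1 : ℝ) :=
      Real.rpow_le_rpow_of_exponent_le (by norm_num) (by norm_num)
    rw [Real.rpow_one] at this
    linarith
  calc _ ≤ 84 * ENNReal.ofReal (|t - s| ^ (-(1 / 4) : ℝ)) *
        (∫⁻ x, ‖h (x, s)‖ₑ ^ (8 / 7 : ℝ)) ^ (7 / 8 : ℝ) *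
        (∫⁻ x, ‖φ x‖ₑ ^ (8 / 7 : ℝ)) ^ (7 / 8 : ℝ) := by gcongr
    _ = _ := by ring

open ComplexConjugate in
theorem lintegral_enorm_pow_eight_eq {f : ℝ → ℝ} (hf : Continuous f) (hfs : HasCompactSupport f) :
    ∫⁻ x, ‖f x‖ₑ ^ (8 : ℝ) = ‖∫ x, conj (((f x) ^ 7 : ℝ) : ℂ) * (f x : ℂ)‖ₑ := by
  have e : ∀ x, conj (((f x) ^ 7 : ℝ) : ℂ) * (f x : ℂ) = ((f x ^ 8 : ℝ) : ℂ) := by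
    intro x; rw [Complex.conj_ofReal]; push_cast; ring
  simp_rw [e]
  have hnn : ∀ x, 0 ≤ f x ^ 8 := fun x => Even.pow_nonneg (by decide) _
  have hi : Integrable fun x => f x ^ 8 :=
    Continuous.integrable_of_hasCompactSupport (by fun_prop)
      (hfs.comp_left (g := fun y : ℝ => y ^ 8) (by simp))
  rw [integral_complex_ofReal, ← ofReal_norm, Complex.norm_real,
    Real.norm_of_nonneg (integral_nonneg hnn), ofReal_integral_eq_lintegral_ofReal hi (ae_of_all _ hnn)]
  congr 1; ext x
  rw [← ofReal_norm, ENNReal.ofReal_rpow_of_nonneg (norm_nonneg _) (by norm_num)]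
  congr 1
  rw [Real.norm_eq_abs, show (8 : ℝ) = ((8 : ℕ) : ℝ) by norm_num, Real.rpow_natCast,
    Even.pow_abs (by decide)]

theorem lintegral_carleman_le {l M : ℝ} (hl : l ≠ 0) {g L : ℝ × ℝ → ℝ} (hg : Continuous g)
    (hL : Continuous L) (hgs : ∀ p, p ∉ Set.Icc (-M) M ×ˢ Set.Icc (0 : ℝ) 1 → g p = 0)
    (hLs : ∀ p, p ∉ Set.Icc (-M) M ×ˢ Set.Icc (0 : ℝ) 1 → L p = 0)
    (hd : ∀ ξ t, HasDerivAt (fun t => carlemanLaplace l (fun x => g (x, t)) ξ)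
      (carlemanLaplace l (fun x => L (x, t)) ξ -
        carlemanRoot l ξ ^ 3 * carlemanLaplace l (fun x => g (x, t)) ξ) t) :
    (∫⁻ p : ℝ × ℝ, ‖Real.exp (l * p.1) * g p‖ₑ ^ (8 : ℝ)) ^ (1 / 8 : ℝ) ≤
      840 * (∫⁻ p : ℝ × ℝ, ‖Real.exp (l * p.1) * L p‖ₑ ^ (8 / 7 : ℝ)) ^ (7 / 8 : ℝ) := by
  set f : ℝ × ℝ → ℝ := fun p => Real.exp (l * p.1) * g p with hf
  set h : ℝ × ℝ → ℝ := fun p => Real.exp (l * p.1) * L p with hh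
  have hfc : Continuous f := by fun_prop
  have hhc : Continuous h := by fun_prop
  have hfz : ∀ p, p ∉ Set.Icc (-M) M ×ˢ Set.Icc (0 : ℝ) 1 → f p = 0 := fun p hp => by
    simp [hf, hgs p hp]
  have hhz : ∀ p, p ∉ Set.Icc (-M) M ×ˢ Set.Icc (0 : ℝ) 1 → h p = 0 := fun p hp => by
    simp [hh, hLs p hp]
  have hMz : ∀ p : ℝ × ℝ, M < |p.1| → p ∉ Set.Icc (-M) M ×ˢ Set.Icc (0 : ℝ) 1 := by
    rintro p hp ⟨h1, _⟩
    rw [Set.mem_Icc, ← abs_le] at h1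
    exact absurd h1 (not_le.2 hp)
  have hlz : ∀ {u : ℝ × ℝ → ℝ} (ξ t : ℝ),
      (∀ p, p ∉ Set.Icc (-M) M ×ˢ Set.Icc (0 : ℝ) 1 → u p = 0) → t ∉ Set.Icc (0 : ℝ) 1 →
      carlemanLaplace l (fun x => u (x, t)) ξ = 0 := by
    intro u ξ t hu ht
    have : (fun x => u (x, t)) = fun _ => 0 := by ext x; exact hu _ fun hp => ht hp.2
    rw [this, carlemanLaplace]; simp
  have hLc : Continuous fun p : ℝ × ℝ => carlemanLaplace l (fun x => L (x, p.2)) p.1 :=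
    continuous_carlemanLaplace hL fun p hp => hLs p (hMz p hp)
  have hsl : ∀ t, HasCompactSupport fun x => f (x, t) := fun t =>
    HasCompactSupport.intro isCompact_Icc fun x hx => hfz (x, t) fun hp => hx hp.1
  set N : ℝ → ENNReal := fun s => (∫⁻ x, ‖h (x, s)‖ₑ ^ (8 / 7 : ℝ)) ^ (7 / 8 : ℝ) with hN
  set Q : ℝ → ENNReal := fun t => (∫⁻ x, ‖f (x, t)‖ₑ ^ (8 : ℝ)) ^ (7 / 8 : ℝ) with hQ
  have hNm0 : Measurable fun s => ∫⁻ x, ‖h (x, s)‖ₑ ^ (8 / 7 : ℝ) :=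
    (hhc.measurable.enorm.pow_const (8 / 7 : ℝ)).lintegral_prod_left'
  have hQm0 : Measurable fun t => ∫⁻ x, ‖f (x, t)‖ₑ ^ (8 : ℝ) :=
    (hfc.measurable.enorm.pow_const (8 : ℝ)).lintegral_prod_left'
  have hNm : Measurable N := hNm0.pow_const _
  have hQm : Measurable Q := hQm0.pow_const _
  have hNi : ∫⁻ s, N s ^ (8 / 7 : ℝ) = ∫⁻ p, ‖h p‖ₑ ^ (8 / 7 : ℝ) := by
    rw [Measure.volume_eq_prod, lintegral_prod_symm' _ (hhc.measurable.enorm.pow_const _)]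
    congr 1; ext s
    rw [hN, ← ENNReal.rpow_mul]; norm_num
  have hJ : ∫⁻ t, ∫⁻ x, ‖f (x, t)‖ₑ ^ (8 : ℝ) = ∫⁻ p, ‖f p‖ₑ ^ (8 : ℝ) := by
    rw [Measure.volume_eq_prod, lintegral_prod_symm' _ (hfc.measurable.enorm.pow_const _)]
  have hQi : ∫⁻ t, Q t ^ (8 / 7 : ℝ) = ∫⁻ p, ‖f p‖ₑ ^ (8 : ℝ) := by
    rw [← hJ]
    congr 1; ext s
    rw [hQ, ← ENNReal.rpow_mul]; norm_num
  have hfin : ∀ {u : ℝ × ℝ → ℝ} {p : ℝ}, Continuous u →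
      (∀ p, p ∉ Set.Icc (-M) M ×ˢ Set.Icc (0 : ℝ) 1 → u p = 0) → 0 < p →
      ∫⁻ q, ‖u q‖ₑ ^ p ≠ ⊤ := by
    intro u p hu hus hp
    have hi : Integrable fun q => |u q| ^ p := by
      apply Continuous.integrable_of_hasCompactSupport (hu.abs.rpow_const fun _ => Or.inr hp.le)
      exact HasCompactSupport.intro (isCompact_Icc.prod isCompact_Icc) fun q hq => by
        rw [hus q hq, abs_zero, Real.zero_rpow hp.ne']
    have h2 := hi.2
    rw [HasFiniteIntegral] at h2
    convert h2.ne using 3 with q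
    rw [Real.enorm_rpow_of_nonneg (abs_nonneg _) hp.le, Real.enorm_abs]
  have slice : ∀ t, ∫⁻ x, ‖f (x, t)‖ₑ ^ (8 : ℝ) ≤
      84 * ∫⁻ s, ENNReal.ofReal (|t - s| ^ (-(1 / 4) : ℝ)) * N s * Q t := by
    intro t
    have hfl : Continuous fun x => f (x, t) := by fun_prop
    rw [lintegral_enorm_pow_eight_eq hfl (hsl t)]
    have hcs : HasCompactSupport fun x => ((f (x, t) : ℝ) : ℂ) :=
      (hsl t).comp_left (g := Complex.ofReal) (by simp)
    have hcs7 : HasCompactSupport fun x => ((f (x, t) ^ 7 : ℝ) : ℂ) :=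
      (hsl t).comp_left (g := fun y : ℝ => ((y ^ 7 : ℝ) : ℂ)) (by simp)
    have key := enorm_integral_conj_mul_le_of_duhamel (M := M) (t := t) hl
      (h := fun p => ((h p : ℝ) : ℂ)) (f := fun x => ((f (x, t) : ℝ) : ℂ))
      (Complex.continuous_ofReal.comp hfl) hcs
      (φ := fun x => ((f (x, t) ^ 7 : ℝ) : ℂ)) (Complex.continuous_ofReal.comp (hfl.pow 7)) hcs7
      (Complex.continuous_ofReal.comp hhc) (fun p hp => by simp [hhz p hp])
      (by simp only [hh, fourier_exp_mul]; exact hLc)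
      (fun ξ hξ => by
        simp only [hf, hh, fourier_exp_mul]
        exact eq_integral_carlemanMul hξ (hd ξ)
          (hLc.comp (f := fun s : ℝ => (ξ, s)) (by fun_prop))
          (fun t ht => hlz ξ t hgs ht) (fun t ht => hlz ξ t hLs ht) t)
    refine key.trans (le_of_eq ?_)
    rw [← lintegral_const_mul' _ _ (by norm_num)]
    congr 1; ext s
    have e7 : ∀ x, ‖((f (x, t) ^ 7 : ℝ) : ℂ)‖ₑ ^ (8 / 7 : ℝ) = ‖f (x, t)‖ₑ ^ (8 : ℝ) := by
      intro x
      rw [← ofReal_norm, Complex.norm_real, ofReal_norm, enorm_pow, ← ENNReal.rpow_natCast,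
        ← ENNReal.rpow_mul]
      norm_num
    have eh : ∀ x, ‖((h (x, s) : ℝ) : ℂ)‖ₑ = ‖h (x, s)‖ₑ := fun x => by
      rw [← ofReal_norm, Complex.norm_real, ofReal_norm]
    simp only [e7, eh, hN, hQ]
    ring
  set J := ∫⁻ p, ‖f p‖ₑ ^ (8 : ℝ) with hJdef
  set P := ∫⁻ p, ‖h p‖ₑ ^ (8 / 7 : ℝ) with hP
  have hJt : J ≠ ⊤ := hfin hfc hfz (by norm_num)
  have main : J ≤ 840 * P ^ (7 / 8 : ℝ) * J ^ (7 / 8 : ℝ) := by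
    calc J = ∫⁻ t, ∫⁻ x, ‖f (x, t)‖ₑ ^ (8 : ℝ) := hJ.symm
      _ ≤ ∫⁻ t, 84 * ∫⁻ s, ENNReal.ofReal (|t - s| ^ (-(1 / 4) : ℝ)) * N s * Q t :=
        lintegral_mono slice
      _ = 84 * ∫⁻ t, ∫⁻ s, ENNReal.ofReal (|t - s| ^ (-(1 / 4) : ℝ)) * N s * Q t :=
        lintegral_const_mul' _ _ (by norm_num)
      _ ≤ 84 * (10 * P ^ (7 / 8 : ℝ) * J ^ (7 / 8 : ℝ)) := by
        gcongr
        have := lintegral_lintegral_abs_rpow_mul_le hNm hQm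
          (by rw [hNi]; exact hfin hhc hhz (by norm_num)) (by rw [hQi]; exact hJt)
        rwa [hNi, hQi] at this
      _ = _ := by ring
  rcases eq_or_ne J 0 with hJ0 | hJ0
  · rw [hJ0, ENNReal.zero_rpow_of_pos (by norm_num)]; exact zero_le
  have hsplit : J ^ (1 / 8 : ℝ) * J ^ (7 / 8 : ℝ) = J := by
    rw [← ENNReal.rpow_add _ _ hJ0 hJt]; norm_num
  have h7 : J ^ (7 / 8 : ℝ) ≠ 0 := fun h0 =>
    hJ0 ((ENNReal.rpow_eq_zero_iff_of_pos (by norm_num)).1 h0)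
  have h7t : J ^ (7 / 8 : ℝ) ≠ ⊤ := ENNReal.rpow_ne_top_of_nonneg (by norm_num) hJt
  rw [← hsplit] at main
  nth_rw 2 [hsplit] at main
  exact (ENNReal.mul_le_mul_iff_left h7 h7t).1 main

theorem pdx_eq_zero {f : ℝ × ℝ → ℝ} {K : Set (ℝ × ℝ)} (hK : IsClosed K)
    (hf : ∀ p, p ∉ K → f p = 0) : ∀ p, p ∉ K → pdx f p = 0 := by
  intro p hp
  have h : ∀ᶠ x in nhds p.1, f (x, p.2) = 0 := by
    have hc : Filter.Tendsto (fun x : ℝ => (x, p.2)) (nhds p.1) (nhds p) :=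
      (by fun_prop : Continuous fun x : ℝ => (x, p.2)).tendsto p.1
    filter_upwards [hc (hK.isOpen_compl.mem_nhds hp)] with x hx using hf _ hx
  exact (Filter.EventuallyEq.deriv_eq h).trans (deriv_const _ _)

theorem pdt_eq_zero {f : ℝ × ℝ → ℝ} {K : Set (ℝ × ℝ)} (hK : IsClosed K)
    (hf : ∀ p, p ∉ K → f p = 0) : ∀ p, p ∉ K → pdt f p = 0 := by
  intro p hp
  have h : ∀ᶠ t in nhds p.2, f (p.1, t) = 0 := by
    have hc : Filter.Tendsto (fun t : ℝ => (p.1, t)) (nhds p.2) (nhds p) :=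
      (by fun_prop : Continuous fun t : ℝ => (p.1, t)).tendsto p.2
    filter_upwards [hc (hK.isOpen_compl.mem_nhds hp)] with x hx using hf _ hx
  exact (Filter.EventuallyEq.deriv_eq h).trans (deriv_const _ _)

theorem C31.hasDerivAt_carlemanLaplace {g : ℝ × ℝ → ℝ} (hg : C31 g) {M : ℝ}
    (hs : ∀ p : ℝ × ℝ, p ∉ Set.Icc (-M) M ×ˢ Set.Icc (0 : ℝ) 1 → g p = 0) (l ξ t : ℝ) :
    HasDerivAt (fun t => carlemanLaplace l (fun x => g (x, t)) ξ)
      (carlemanLaplace l (fun x => pdt g (x, t) + pdx (pdx (pdx g)) (x, t)) ξ -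
        carlemanRoot l ξ ^ 3 * carlemanLaplace l (fun x => g (x, t)) ξ) t := by
  obtain ⟨hx, ht, c0, c1, c2, c3, ct⟩ := hg
  have hK : IsClosed (Set.Icc (-M) M ×ˢ Set.Icc (0 : ℝ) 1) := isClosed_Icc.prod isClosed_Icc
  have hMz : ∀ p : ℝ × ℝ, M < |p.1| → p ∉ Set.Icc (-M) M ×ˢ Set.Icc (0 : ℝ) 1 := by
    rintro p hp ⟨h1, _⟩
    rw [Set.mem_Icc, ← abs_le] at h1
    exact absurd h1 (not_le.2 hp)
  have s1 := pdx_eq_zero hK hs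
  have s2 := pdx_eq_zero hK s1
  have s3 := pdx_eq_zero hK s2
  have st := pdt_eq_zero hK hs
  have r1 : ∀ s, ContDiff ℝ 2 (fun x => pdx g (x, s)) := fun s =>
    ((contDiff_succ_iff_deriv (n := 2)).1 (hx s)).2.2
  have r2 : ∀ s, ContDiff ℝ 1 (fun x => pdx (pdx g) (x, s)) := fun s =>
    ((contDiff_succ_iff_deriv (n := 1)).1 (r1 s)).2.2
  have h0 : ∀ s x, HasDerivAt (fun x => g (x, s)) (pdx g (x, s)) x := fun s x =>
    ((hx s).differentiable (by norm_num) x).hasDerivAt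
  have h1 : ∀ s x, HasDerivAt (fun x => pdx g (x, s)) (pdx (pdx g) (x, s)) x := fun s x =>
    ((r1 s).differentiable (by norm_num) x).hasDerivAt
  have h2 : ∀ s x, HasDerivAt (fun x => pdx (pdx g) (x, s)) (pdx (pdx (pdx g)) (x, s)) x :=
    fun s x => ((r2 s).differentiable (by norm_num) x).hasDerivAt
  have z : ∀ {u : ℝ × ℝ → ℝ}, (∀ p : ℝ × ℝ, p ∉ Set.Icc (-M) M ×ˢ Set.Icc (0 : ℝ) 1 → u p = 0) →
      ∀ x, M < |x| → u (x, t) = 0 := fun hu x hx => hu _ (hMz (x, t) hx)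
  have third := carlemanLaplace_third_deriv (l := l) (h0 t) (h1 t) (h2 t)
    (c3.comp (f := fun x : ℝ => (x, t)) (by fun_prop)) (z hs) (z s1) (z s2) (z s3) ξ
  have time := _root_.hasDerivAt_carlemanLaplace (l := l) c0 ct
    (fun x t => (ht x t).hasDerivAt) (fun p hp => hs p (hMz p hp)) (fun p hp => st p (hMz p hp))
    (HasCompactSupport.intro (isCompact_Icc.prod isCompact_Icc) st) ξ t
  have sum : carlemanLaplace l (fun x => pdt g (x, t) + pdx (pdx (pdx g)) (x, t)) ξ =
      carlemanLaplace l (fun x => pdt g (x, t)) ξ +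
        carlemanLaplace l (fun x => pdx (pdx (pdx g)) (x, t)) ξ := by
    simp only [carlemanLaplace]
    have it : Integrable fun x : ℝ =>
        Complex.exp (-(carlemanRoot l ξ * x)) * (pdt g (x, t) : ℂ) :=
      integrable_cexp_neg_mul_mul (u := fun x => pdt g (x, t))
        (ct.comp (f := fun x : ℝ => (x, t)) (by fun_prop)) (z st) _
    have i3 : Integrable fun x : ℝ =>
        Complex.exp (-(carlemanRoot l ξ * x)) * (pdx (pdx (pdx g)) (x, t) : ℂ) :=
      integrable_cexp_neg_mul_mul (u := fun x => pdx (pdx (pdx g)) (x, t))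
        (c3.comp (f := fun x : ℝ => (x, t)) (by fun_prop)) (z s3) _
    rw [← integral_add it i3]
    congr 1; ext x
    push_cast
    ring
  rw [sum, third, add_sub_cancel_right]
  exact time

theorem eLpNorm_carleman_le {l M : ℝ} (hl : l ≠ 0) {g : ℝ × ℝ → ℝ} (hg : C31 g)
    (hs : ∀ p : ℝ × ℝ, p ∉ Set.Icc (-M) M ×ˢ Set.Icc (0 : ℝ) 1 → g p = 0) :
    eLpNorm (fun p => Real.exp (l * p.1) * g p) 8
        (volume.restrict ((Set.univ : Set ℝ) ×ˢ Set.Icc (0 : ℝ) 1)) ≤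
      840 * eLpNorm (fun p => Real.exp (l * p.1) * (pdt g p + pdx (pdx (pdx g)) p)) (8 / 7)
        (volume.restrict ((Set.univ : Set ℝ) ×ˢ Set.Icc (0 : ℝ) 1)) := by
  have hK : IsClosed (Set.Icc (-M) M ×ˢ Set.Icc (0 : ℝ) 1) := isClosed_Icc.prod isClosed_Icc
  have hLs : ∀ p : ℝ × ℝ, p ∉ Set.Icc (-M) M ×ˢ Set.Icc (0 : ℝ) 1 →
      pdt g p + pdx (pdx (pdx g)) p = 0 := fun p hp => by
    rw [pdt_eq_zero hK hs p hp,
      pdx_eq_zero hK (pdx_eq_zero hK (pdx_eq_zero hK hs)) p hp, add_zero]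
  rw [eLpNorm_restrict_eq_of_support_subset (p := 8 / 7)]
  · refine (eLpNorm_mono_measure _ Measure.restrict_le_self).trans ?_
    have := lintegral_carleman_le hl hg.2.2.1 (hg.2.2.2.2.2.2.add hg.2.2.2.2.2.1) hs hLs
      (hg.hasDerivAt_carlemanLaplace hs l)
    have e : (8 / 7 : ENNReal).toReal = 8 / 7 := by simp
    rw [eLpNorm_eq_lintegral_rpow_enorm_toReal (by norm_num) (by norm_num),
      eLpNorm_eq_lintegral_rpow_enorm_toReal (by simp) (ENNReal.div_ne_top (by simp) (by simp)), e]
    simpa using this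
  · intro p hp
    refine ⟨Set.mem_univ _, ?_⟩
    by_contra h
    exact hp (by simp only; rw [hLs p fun hp => h hp.2, mul_zero])

theorem stmt13 : ∃ c : ℝ, 0 < c ∧ ∀ (M : ℝ) (g : ℝ × ℝ → ℝ), C31 g →
    (∀ p : ℝ × ℝ, p ∉ Set.Icc (-M) M ×ˢ Set.Icc (0:ℝ) 1 → g p = 0) →
    (∀ x : ℝ, g (x, 0) = 0 ∧ g (x, 1) = 0) →
    ∀ lam : ℝ,
      eLpNorm (fun p => Real.exp (lam * p.1) * g p) 8
          (volume.restrict ((Set.univ : Set ℝ) ×ˢ Set.Icc (0:ℝ) 1)) ≤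
        ENNReal.ofReal c *
          eLpNorm (fun p => Real.exp (lam * p.1) * (pdt g p + pdx (pdx (pdx g)) p)) (8/7)
            (volume.restrict ((Set.univ : Set ℝ) ×ˢ Set.Icc (0:ℝ) 1)) := by
  refine ⟨3360, by norm_num, fun M g hg hs _ lam => ?_⟩
  rcases eq_or_ne lam 0 with rfl | hlam
  · set ε : ℝ := Real.log 2 / (|M| + 1) with hε
    have hlog : 0 < Real.log 2 := Real.log_pos (by norm_num)
    have hε0 : 0 < ε := by positivity
    have hεM : ∀ x ∈ Set.Icc (-M) M, |ε * x| ≤ Real.log 2 := by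
      intro x hx
      have h1 : |x| ≤ |M| := (abs_le.2 hx).trans (le_abs_self M)
      rw [abs_mul, abs_of_pos hε0, hε, div_mul_eq_mul_div, div_le_iff₀ (by positivity)]
      nlinarith
    have hup : ∀ x ∈ Set.Icc (-M) M, Real.exp (ε * x) ≤ 2 := fun x hx => by
      rw [← Real.exp_log (show (0 : ℝ) < 2 by norm_num)]
      exact Real.exp_le_exp.2 (abs_le.1 (hεM x hx)).2
    have hlo : ∀ x ∈ Set.Icc (-M) M, 1 ≤ 2 * Real.exp (ε * x) := fun x hx => by
      have h2 : Real.exp (-(ε * x)) ≤ 2 := by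
        rw [← Real.exp_log (show (0 : ℝ) < 2 by norm_num)]
        exact Real.exp_le_exp.2 (by linarith [(abs_le.1 (hεM x hx)).1])
      calc 1 = Real.exp (-(ε * x)) * Real.exp (ε * x) := by rw [← Real.exp_add]; simp
        _ ≤ 2 * Real.exp (ε * x) := by gcongr
    have hK : IsClosed (Set.Icc (-M) M ×ˢ Set.Icc (0 : ℝ) 1) := isClosed_Icc.prod isClosed_Icc
    have hLs : ∀ p : ℝ × ℝ, p ∉ Set.Icc (-M) M ×ˢ Set.Icc (0 : ℝ) 1 →
        pdt g p + pdx (pdx (pdx g)) p = 0 := fun p hp => by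
      rw [pdt_eq_zero hK hs p hp,
        pdx_eq_zero hK (pdx_eq_zero hK (pdx_eq_zero hK hs)) p hp, add_zero]
    have b1 := eLpNorm_le_mul_eLpNorm_of_ae_le_mul
      (μ := volume.restrict ((Set.univ : Set ℝ) ×ˢ Set.Icc (0:ℝ) 1))
      (f := fun p : ℝ × ℝ => Real.exp (0 * p.1) * g p)
      (g := fun p : ℝ × ℝ => Real.exp (ε * p.1) * g p) (c := 2)
      (ae_of_all _ fun p => by
        by_cases hp : p ∈ Set.Icc (-M) M ×ˢ Set.Icc (0 : ℝ) 1
        · rw [zero_mul, Real.exp_zero, one_mul, norm_mul, Real.norm_of_nonneg (Real.exp_pos _).le,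
            ← mul_assoc]
          exact le_mul_of_one_le_left (norm_nonneg _) (hlo _ hp.1)
        · simp [hs p hp]) 8
    have b2 := eLpNorm_le_mul_eLpNorm_of_ae_le_mul
      (μ := volume.restrict ((Set.univ : Set ℝ) ×ˢ Set.Icc (0:ℝ) 1))
      (f := fun p : ℝ × ℝ => Real.exp (ε * p.1) * (pdt g p + pdx (pdx (pdx g)) p))
      (g := fun p : ℝ × ℝ => Real.exp (0 * p.1) * (pdt g p + pdx (pdx (pdx g)) p)) (c := 2)
      (ae_of_all _ fun p => by
        by_cases hp : p ∈ Set.Icc (-M) M ×ˢ Set.Icc (0 : ℝ) 1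
        · rw [zero_mul, Real.exp_zero, norm_mul, Real.norm_of_nonneg (Real.exp_pos _).le, one_mul]
          exact mul_le_mul_of_nonneg_right (hup _ hp.1) (norm_nonneg _)
        · simp [hLs p hp]) (8 / 7)
    refine b1.trans ((mul_le_mul_right (eLpNorm_carleman_le hε0.ne' hg hs) _).trans
      ((mul_le_mul_right (mul_le_mul_right b2 _) _).trans (le_of_eq ?_)))
    rw [← mul_assoc, ← mul_assoc]
    congr 1
    norm_num
  · refine (eLpNorm_carleman_le hlam hg hs).trans ?_
    gcongr
    norm_num
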